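/- Let q = p^e > 7 be a prime power with p prime, and set d = gcd(2, q−1). Then PSL₂(q) admits an unmixed Beauville structure of type (((q−1)/d, (q−1)/d, (q−1)/d), ((q+1)/d, (q+1)/d, p)). -/

import Mathlib

open Matrix

/-- The projective special linear group `PSL₂(F) = SL(2, F) / Z(SL(2, F))`. -/
abbrev PSL2 (F : Type*) [Field F] :=
  Matrix.SpecialLinearGroup (Fin 2) F ⧸ Subgroup.center (Matrix.SpecialLinearGroup (Fin 2) F)

/-- `Σ(a)`: the union of the conjugacy classes of all powers of `a`. -/
def conjPowers {G : Type*} [Group G] (a : G) : Set G :=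
  {x | ∃ (g : G) (j : ℕ), x = g * a ^ j * g⁻¹}

/-- `Σ(a, b, c)`: the union of the conjugacy classes of all powers of `a`, of `b`, and
of `c`. -/
def sigma3 {G : Type*} [Group G] (a b c : G) : Set G :=
  conjPowers a ∪ conjPowers b ∪ conjPowers c

/-- An unmixed Beauville structure for a group `G`: two triples, each with product `1` and
generating `G`, whose `Σ`-sets intersect trivially. -/
def IsUnmixedBeauville {G : Type*} [Group G] (a₁ b₁ c₁ a₂ b₂ c₂ : G) : Prop :=
  a₁ * b₁ * c₁ = 1 ∧ a₂ * b₂ * c₂ = 1 ∧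
  Subgroup.closure ({a₁, b₁} : Set G) = ⊤ ∧ Subgroup.closure ({a₂, b₂} : Set G) = ⊤ ∧
  sigma3 a₁ b₁ c₁ ∩ sigma3 a₂ b₂ c₂ = {1}

/-- `G` admits an unmixed Beauville structure of type `((r₁,s₁,t₁),(r₂,s₂,t₂))`. -/
def HasBeauvilleOfType (G : Type*) [Group G] (r₁ s₁ t₁ r₂ s₂ t₂ : ℕ) : Prop :=
  ∃ a₁ b₁ c₁ a₂ b₂ c₂ : G, IsUnmixedBeauville a₁ b₁ c₁ a₂ b₂ c₂ ∧
    orderOf a₁ = r₁ ∧ orderOf b₁ = s₁ ∧ orderOf c₁ = t₁ ∧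
    orderOf a₂ = r₂ ∧ orderOf b₂ = s₂ ∧ orderOf c₂ = t₂

open scoped MatrixGroups

section Orders

variable {F : Type*} [Field F]

namespace Matrix.SpecialLinearGroup

lemma det_two_eq_one (g : SL(2, F)) : g 0 0 * g 1 1 - g 0 1 * g 1 0 = 1 := by
  rw [← Matrix.det_fin_two]
  exact g.det_coe

lemma mem_center_two_iff (g : SL(2, F)) :
    g ∈ Subgroup.center SL(2, F) ↔ g 0 1 = 0 ∧ g 1 0 = 0 ∧ g 0 0 = g 1 1 := by
  rw [Matrix.SpecialLinearGroup.mem_center_iff]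
  constructor
  · rintro ⟨r, -, hr⟩
    simp [← hr]
  · rintro ⟨h01, h10, h00⟩
    have hdet := det_two_eq_one g
    refine ⟨g 1 1, ?_, ?_⟩
    · rw [h00, h01] at hdet
      simp only [Fintype.card_fin]
      linear_combination hdet
    · ext i j
      fin_cases i <;> fin_cases j <;> simp [h01, h10, h00]

/-- Closed form for the powers of a unimodular `2 × 2` matrix with eigenvalues `l` and `l⁻¹`. -/
lemma smul_pow_eq (g : SL(2, F)) {l : F} (hl : l ≠ 0) (ht : g 0 0 + g 1 1 = l + l⁻¹) (n : ℕ) :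
    (l - l⁻¹) • (g : Matrix (Fin 2) (Fin 2) F) ^ n =
      (l ^ n - l⁻¹ ^ n) • (g : Matrix (Fin 2) (Fin 2) F) +
        (l * l⁻¹ ^ n - l⁻¹ * l ^ n) • (1 : Matrix (Fin 2) (Fin 2) F) := by
  have hdet := det_two_eq_one g
  have hch : (g : Matrix (Fin 2) (Fin 2) F) * g =
      (l + l⁻¹) • (g : Matrix (Fin 2) (Fin 2) F) - 1 := by
    rw [← ht]
    ext i j
    fin_cases i <;> fin_cases j <;> simp [Matrix.mul_apply, Fin.sum_univ_two] <;> grind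
  have hli : l * l⁻¹ = 1 := mul_inv_cancel₀ hl
  induction n with
  | zero => simp
  | succ n ih =>
    rw [pow_succ, ← smul_mul_assoc, ih, add_mul, smul_mul_assoc, hch, smul_mul_assoc, one_mul]
    generalize l⁻¹ = m at *
    ext i j
    simp only [Matrix.add_apply, Matrix.smul_apply, Matrix.sub_apply, smul_eq_mul]
    generalize (1 : Matrix (Fin 2) (Fin 2) F) i j = e
    linear_combination ((l ^ n - m ^ n) * e) * hli

variable {K : Type*} [Field K] [Algebra F K]

/-- Closed form for the entries of the powers of a unimodular `2 × 2` matrix whose eigenvalues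
`l` and `l⁻¹` lie in an extension field. -/
lemma algebraMap_pow_apply (g : SL(2, F)) {l : K} (hl : l ≠ 0)
    (ht : algebraMap F K (g 0 0 + g 1 1) = l + l⁻¹) (n : ℕ) (i j : Fin 2) :
    (l - l⁻¹) * algebraMap F K ((g ^ n) i j) = (l ^ n - l⁻¹ ^ n) * algebraMap F K (g i j) +
      (l * l⁻¹ ^ n - l⁻¹ * l ^ n) * (1 : Matrix (Fin 2) (Fin 2) K) i j := by
  have key := smul_pow_eq (map (algebraMap F K) g) hl (by simpa using ht) n
  rw [← coe_pow, ← map_pow] at key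
  exact congrFun (congrFun key i) j

/-- The `n`-th power of a non-scalar matrix is scalar iff its eigenvalues agree. -/
lemma pow_mem_center_iff (g : SL(2, F)) {l : K} (hl : l ≠ 0) (hl2 : l ^ 2 ≠ 1)
    (ht : algebraMap F K (g 0 0 + g 1 1) = l + l⁻¹) (n : ℕ) :
    g ^ n ∈ Subgroup.center SL(2, F) ↔ (l ^ 2) ^ n = 1 := by
  have hli : l * l⁻¹ = 1 := mul_inv_cancel₀ hl
  have hsub : l - l⁻¹ ≠ 0 := by
    intro h
    apply hl2
    linear_combination l * h + hli
  have key := algebraMap_pow_apply g hl ht n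
  have hpow : (l ^ 2) ^ n = 1 ↔ l ^ n - l⁻¹ ^ n = 0 := by
    rw [inv_pow, sub_eq_zero, ← mul_eq_one_iff_eq_inv₀ (pow_ne_zero _ hl), ← pow_mul,
      mul_comm 2 n, pow_mul, sq]
  rw [hpow, mem_center_two_iff]
  have inj : Function.Injective (algebraMap F K) := (algebraMap F K).injective
  generalize g ^ n = y at *
  generalize algebraMap F K = φ at *
  have k01 := key 0 1
  have k10 := key 1 0
  have k00 := key 0 0
  have k11 := key 1 1
  simp only [Matrix.one_apply_eq, ne_eq, zero_ne_one, one_ne_zero, not_false_eq_true,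
    Matrix.one_apply_ne, mul_zero, add_zero, mul_one] at k00 k11 k01 k10
  have hdet := det_two_eq_one g
  constructor
  · rintro ⟨e01, e10, e00⟩
    by_contra hne
    rw [e01, map_zero, mul_zero, eq_comm, mul_eq_zero] at k01
    have h01 : g 0 1 = 0 := inj (by rw [map_zero]; exact k01.resolve_left hne)
    rw [e00, k11] at k00
    have h00 : g 0 0 = g 1 1 := by
      apply inj
      apply mul_left_cancel₀ hne
      linear_combination -k00
    rw [h01, h00] at hdet
    have hd : φ (g 1 1) * φ (g 1 1) = 1 := by
      rw [← map_mul, ← map_one φ]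
      congr 1
      linear_combination hdet
    rw [h00, map_add] at ht
    have : (l - φ (g 1 1)) ^ 2 = 0 := by linear_combination hd - l * ht - hli
    apply hl2
    rw [sub_eq_zero.1 (pow_eq_zero_iff (two_ne_zero) |>.1 this), sq, hd]
  · intro h
    have h2 : l⁻¹ ^ n = l ^ n := (sub_eq_zero.1 h).symm
    rw [h2, sub_self, zero_mul] at k01 k10 k00 k11
    refine ⟨inj ?_, inj ?_, inj ?_⟩ <;> apply mul_left_cancel₀ hsub
    · rw [k01]; simp
    · rw [k10]; simp
    · rw [k00, k11]

end Matrix.SpecialLinearGroup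

lemma orderOf_mk_PSL2 {K : Type*} [Field K] [Algebra F K] (g : SL(2, F)) {l : K} (hl : l ≠ 0)
    (hl2 : l ^ 2 ≠ 1) (ht : algebraMap F K (g 0 0 + g 1 1) = l + l⁻¹) :
    orderOf (g : PSL2 F) = orderOf (l ^ 2) := by
  refine orderOf_eq_orderOf_iff.2 fun n => ?_
  rw [← Matrix.SpecialLinearGroup.pow_mem_center_iff g hl hl2 ht n, ← QuotientGroup.mk_pow,
    QuotientGroup.eq_one_iff]

end Orders

section GroupTheory

variable {G : Type*} [Group G]

lemma orderOf_dvd_of_mem_conjPowers {a x : G} (h : x ∈ conjPowers a) :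
    orderOf x ∣ orderOf a := by
  obtain ⟨g, j, rfl⟩ := h
  refine orderOf_dvd_of_pow_eq_one ?_
  rw [conj_pow, ← pow_mul, mul_comm j, pow_mul, pow_orderOf_eq_one]
  simp

lemma one_mem_sigma3 (a b c : G) : (1 : G) ∈ sigma3 a b c :=
  Or.inl (Or.inl ⟨1, 0, by simp⟩)

lemma sigma3_inter_eq_one {a b c a' b' c' : G} {m n : ℕ}
    (ha : orderOf a ∣ m) (hb : orderOf b ∣ m) (hc : orderOf c ∣ m)
    (ha' : orderOf a' ∣ n) (hb' : orderOf b' ∣ n) (hc' : orderOf c' ∣ n) (h : m.Coprime n) :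
    sigma3 a b c ∩ sigma3 a' b' c' = {1} := by
  ext x
  simp only [Set.mem_inter_iff, Set.mem_singleton_iff]
  constructor
  · rintro ⟨h1, h2⟩
    have hm : orderOf x ∣ m := by
      rcases h1 with (h1 | h1) | h1
      exacts [(orderOf_dvd_of_mem_conjPowers h1).trans ha,
        (orderOf_dvd_of_mem_conjPowers h1).trans hb, (orderOf_dvd_of_mem_conjPowers h1).trans hc]
    have hn : orderOf x ∣ n := by
      rcases h2 with (h2 | h2) | h2
      exacts [(orderOf_dvd_of_mem_conjPowers h2).trans ha',
        (orderOf_dvd_of_mem_conjPowers h2).trans hb', (orderOf_dvd_of_mem_conjPowers h2).trans hc']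
    exact orderOf_eq_one_iff.1 (Nat.eq_one_of_dvd_coprimes h hm hn)
  · rintro rfl
    exact ⟨one_mem_sigma3 _ _ _, one_mem_sigma3 _ _ _⟩

lemma closure_mk_eq_top {N : Subgroup G} [N.Normal] {a b : G}
    (h : Subgroup.closure ({a, b} : Set G) = ⊤) :
    Subgroup.closure ({(a : G ⧸ N), (b : G ⧸ N)} : Set (G ⧸ N)) = ⊤ := by
  have := congrArg (Subgroup.map (QuotientGroup.mk' N)) h
  rw [MonoidHom.map_closure, Set.image_pair,
    Subgroup.map_top_of_surjective _ (QuotientGroup.mk'_surjective N)] at this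
  exact this

end GroupTheory

section Generation

variable {F : Type*} [Field F]

lemma Matrix.SpecialLinearGroup.ext_two {g h : SL(2, F)} (h00 : g 0 0 = h 0 0)
    (h01 : g 0 1 = h 0 1) (h10 : g 1 0 = h 1 0) (h11 : g 1 1 = h 1 1) : g = h := by
  ext i j
  fin_cases i <;> fin_cases j <;> assumption

/-- The upper unipotent matrix with off-diagonal entry `b`. -/
def upperSL (b : F) : SL(2, F) := ⟨!![1, b; 0, 1], by simp⟩

/-- The lower unipotent matrix with off-diagonal entry `c`. -/
def lowerSL (c : F) : SL(2, F) := ⟨!![1, 0; c, 1], by simp⟩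

/-- The diagonal matrix with entries `x` and `x⁻¹`. -/
def diagSL (x : Fˣ) : SL(2, F) := ⟨!![(x : F), 0; 0, (x : F)⁻¹], by simp⟩

@[simp] lemma upperSL_00 (b : F) : upperSL b 0 0 = 1 := rfl
@[simp] lemma upperSL_01 (b : F) : upperSL b 0 1 = b := rfl
@[simp] lemma upperSL_10 (b : F) : upperSL b 1 0 = 0 := rfl
@[simp] lemma upperSL_11 (b : F) : upperSL b 1 1 = 1 := rfl
@[simp] lemma lowerSL_00 (c : F) : lowerSL c 0 0 = 1 := rfl
@[simp] lemma lowerSL_01 (c : F) : lowerSL c 0 1 = 0 := rfl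
@[simp] lemma lowerSL_10 (c : F) : lowerSL c 1 0 = c := rfl
@[simp] lemma lowerSL_11 (c : F) : lowerSL c 1 1 = 1 := rfl
@[simp] lemma diagSL_00 (x : Fˣ) : diagSL x 0 0 = x := rfl
@[simp] lemma diagSL_01 (x : Fˣ) : diagSL x 0 1 = 0 := rfl
@[simp] lemma diagSL_10 (x : Fˣ) : diagSL x 1 0 = 0 := rfl
@[simp] lemma diagSL_11 (x : Fˣ) : diagSL x 1 1 = (x : F)⁻¹ := rfl

lemma diagSL_mul (x y : Fˣ) : diagSL (x * y) = diagSL x * diagSL y := by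
  apply Matrix.SpecialLinearGroup.ext_two <;>
    simp [Matrix.mul_apply, Fin.sum_univ_two, mul_comm]

/-- The diagonal torus, as a homomorphism from the units. -/
def diagHom : Fˣ →* SL(2, F) where
  toFun := diagSL
  map_one' := by
    apply Matrix.SpecialLinearGroup.ext_two <;>
      simp
  map_mul' := diagSL_mul

lemma diagSL_mem_of_generator {H : Subgroup SL(2, F)} {z : Fˣ} {Q : SL(2, F)}
    (hz : ∀ x : Fˣ, x ∈ Subgroup.zpowers z) (h : Q * diagSL z * Q⁻¹ ∈ H) (x : Fˣ) :
    Q * diagSL x * Q⁻¹ ∈ H := by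
  obtain ⟨n, rfl⟩ := hz x
  have : diagSL (z ^ n) = diagSL z ^ n := map_zpow diagHom z n
  rw [this, ← conj_zpow]
  exact H.zpow_mem h n

lemma upperSL_add (a b : F) : upperSL (a + b) = upperSL a * upperSL b := by
  apply Matrix.SpecialLinearGroup.ext_two <;>
    simp [Matrix.mul_apply, Fin.sum_univ_two, add_comm]

lemma upperSL_zero : upperSL (0 : F) = 1 := by
  apply Matrix.SpecialLinearGroup.ext_two <;>
    simp

lemma upperSL_neg (a : F) : upperSL (-a) = (upperSL a)⁻¹ := by
  rw [eq_inv_iff_mul_eq_one, ← upperSL_add, neg_add_cancel, upperSL_zero]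

lemma diag_conj_upperSL (x : Fˣ) (b : F) :
    diagSL x * upperSL b * (diagSL x)⁻¹ = upperSL ((x : F) ^ 2 * b) := by
  rw [mul_inv_eq_iff_eq_mul]
  apply Matrix.SpecialLinearGroup.ext_two <;>
    simp [Matrix.mul_apply, Fin.sum_univ_two]
  field_simp

/-- The group of upper unipotents together with any matrix that is not upper triangular
generates `SL(2, F)`. -/
lemma eq_top_of_forall_upperSL_mem {H : Subgroup SL(2, F)} (hU : ∀ b : F, upperSL b ∈ H)
    {h : SL(2, F)} (hh : h ∈ H) (hc : h 1 0 ≠ 0) : H = ⊤ := by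
  have hdet := h.det_two_eq_one
  have hL : ∀ c : F, lowerSL c ∈ H := by
    intro c
    have hn : upperSL (-(h 0 0 / h 1 0)) * h * upperSL (-(h 1 1 / h 1 0)) ∈ H :=
      H.mul_mem (H.mul_mem (hU _) hh) (hU _)
    set n := upperSL (-(h 0 0 / h 1 0)) * h * upperSL (-(h 1 1 / h 1 0)) with hn'
    have e10 : n 1 0 = h 1 0 := by
      simp [hn', Matrix.mul_apply, Fin.sum_univ_two]
    have e11 : n 1 1 = 0 := by
      simp [hn', Matrix.mul_apply, Fin.sum_univ_two]
      field_simp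
      ring
    have e00 : n 0 0 = 0 := by
      simp [hn', Matrix.mul_apply, Fin.sum_univ_two]
      field_simp
      ring
    have hdn := n.det_two_eq_one
    rw [e10, e11] at hdn
    have : lowerSL c * n = n * upperSL (-(c * (n 0 1) ^ 2)) := by
      apply Matrix.SpecialLinearGroup.ext_two <;>
        simp [Matrix.mul_apply, Fin.sum_univ_two, e00, e11, e10]
      linear_combination (-c * n 0 1) * hdn
    rw [← mul_inv_eq_iff_eq_mul.2 this.symm]
    exact H.mul_mem (H.mul_mem hn (hU _)) (H.inv_mem hn)
  have key : ∀ g : SL(2, F), g 1 0 ≠ 0 → g ∈ H := by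
    intro g hg
    have hd := g.det_two_eq_one
    have : g = upperSL ((g 0 0 - 1) / g 1 0) * lowerSL (g 1 0) *
        upperSL ((g 1 1 - 1) / g 1 0) := by
      apply Matrix.SpecialLinearGroup.ext_two <;>
        simp [Matrix.mul_apply, Fin.sum_univ_two] <;> field_simp <;> grind
    rw [this]
    exact H.mul_mem (H.mul_mem (hU _) (hL _)) (hU _)
  refine (Subgroup.eq_top_iff' H).2 fun g => ?_
  by_cases hg : g 1 0 = 0
  · have hd := g.det_two_eq_one
    have h1 : lowerSL 1 * g ∈ H := by
      apply key
      simp [Matrix.mul_apply, Fin.sum_univ_two, hg]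
      intro h0
      simp [h0, hg] at hd
    exact (H.mul_mem_cancel_left (hL 1)).1 h1
  · exact key g hg

/-- The quadratic form whose zeros are the eigenvectors of `g`. -/
def eigForm (g : SL(2, F)) (a c : F) : F := g 1 0 * a ^ 2 + (g 1 1 - g 0 0) * a * c - g 0 1 * c ^ 2

lemma conj_apply_one_zero (g Q : SL(2, F)) :
    (Q⁻¹ * g * Q) 1 0 = eigForm g (Q 0 0) (Q 1 0) := by
  simp [eigForm, Matrix.mul_apply, Fin.sum_univ_two, Matrix.SpecialLinearGroup.coe_inv,
    Matrix.adjugate_fin_two, Matrix.vecMul, dotProduct]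
  ring

lemma conj_apply_zero_one (g Q : SL(2, F)) :
    (Q⁻¹ * g * Q) 0 1 = -eigForm g (Q 0 1) (Q 1 1) := by
  simp [eigForm, Matrix.mul_apply, Fin.sum_univ_two, Matrix.SpecialLinearGroup.coe_inv,
    Matrix.adjugate_fin_two, Matrix.vecMul, dotProduct]
  ring

lemma eigForm_conj_diagSL (g : SL(2, F)) (x : Fˣ) (a c : F) :
    eigForm (diagSL x * g * (diagSL x)⁻¹) a c = eigForm g ((x : F)⁻¹ * a) ((x : F) * c) := by
  simp [eigForm, Matrix.mul_apply, Fin.sum_univ_two, Matrix.SpecialLinearGroup.coe_inv,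
    Matrix.adjugate_fin_two, Matrix.vecMul, dotProduct]
  field_simp

variable [Finite F]

/-- Over a finite field, a subgroup containing the full diagonal torus and a triangular
non-diagonal matrix contains all upper unipotents. -/
lemma upperSL_mem_of_triangular {H : Subgroup SL(2, F)} {z : Fˣ} (hz2 : (z : F) ^ 2 ≠ 1)
    (hz : ∀ x : Fˣ, x ∈ Subgroup.zpowers z) (hA : diagSL z ∈ H) {g : SL(2, F)} (hg : g ∈ H)
    (h10 : g 1 0 = 0) (h01 : g 0 1 ≠ 0) (b : F) : upperSL b ∈ H := by
  have hd := g.det_two_eq_one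
  rw [h10] at hd
  have hg00 : g 0 0 ≠ 0 := by
    intro h
    simp [h] at hd
  set b₀ := g 0 0 * g 0 1 * ((z : F) ^ 2 - 1) with hb₀
  have hb : b₀ ≠ 0 := mul_ne_zero (mul_ne_zero hg00 h01) (sub_ne_zero.2 hz2)
  have hmem : upperSL b₀ ∈ H := by
    have : upperSL b₀ = diagSL z * g * (diagSL z)⁻¹ * g⁻¹ := by
      rw [eq_mul_inv_iff_mul_eq, eq_mul_inv_iff_mul_eq]
      apply Matrix.SpecialLinearGroup.ext_two <;>
        simp [Matrix.mul_apply, Fin.sum_univ_two, h10, hb₀] <;> field_simp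
      linear_combination ((z : F) ^ 2 - 1) * hd
    rw [this]
    exact H.mul_mem (H.mul_mem (H.mul_mem hA hg) (H.inv_mem hA)) (H.inv_mem hg)
  have hdiag : ∀ x : Fˣ, diagSL x ∈ H := by
    intro x
    have := diagSL_mem_of_generator (H := H) (Q := 1) hz (by simpa using hA) x
    simpa using this
  have hsq : ∀ s : F, upperSL (s ^ 2 * b₀) ∈ H := by
    intro s
    by_cases hs : s = 0
    · rw [hs]
      simp [upperSL_zero, H.one_mem]
    · have := diag_conj_upperSL (Units.mk0 s hs) b₀
      rw [Units.val_mk0] at this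
      rw [← this]
      exact H.mul_mem (H.mul_mem (hdiag _) hmem) (H.inv_mem (hdiag _))
  by_cases h2 : ringChar F = 2
  · obtain ⟨s, hs⟩ := FiniteField.isSquare_of_char_two h2 (b / b₀)
    have := hsq s
    rwa [sq, ← hs, div_mul_cancel₀ _ hb] at this
  · have h2' : (2 : F) ≠ 0 := Ring.two_ne_zero h2
    have := H.mul_mem (hsq ((b / b₀ + 1) / 2)) (H.inv_mem (hsq ((b / b₀ - 1) / 2)))
    rw [← upperSL_neg, ← upperSL_add] at this
    convert this using 2
    field_simp
    ring

end Generation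

section SplitTriple

variable {F : Type*} [Field F]

/-- The Weyl element. -/
def weylSL (F : Type*) [Field F] : SL(2, F) := ⟨!![0, -1; 1, 0], by simp⟩

@[simp] lemma weylSL_00 (F : Type*) [Field F] : weylSL F 0 0 = 0 := rfl
@[simp] lemma weylSL_01 (F : Type*) [Field F] : weylSL F 0 1 = -1 := rfl
@[simp] lemma weylSL_10 (F : Type*) [Field F] : weylSL F 1 0 = 1 := rfl
@[simp] lemma weylSL_11 (F : Type*) [Field F] : weylSL F 1 1 = 0 := rfl

lemma weylSL_conj_diagSL (x : Fˣ) : weylSL F * diagSL x * (weylSL F)⁻¹ = diagSL x⁻¹ := by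
  rw [mul_inv_eq_iff_eq_mul]
  apply Matrix.SpecialLinearGroup.ext_two <;> simp [Matrix.mul_apply, Fin.sum_univ_two]

lemma exists_sq_eq_or_mul_sq_eq {z : Fˣ} (hz : ∀ x : Fˣ, x ∈ Subgroup.zpowers z) (r y : Fˣ)
    (hr : ¬ IsSquare r) : ∃ k : Fˣ, k ^ 2 = y ∨ r * k ^ 2 = y := by
  obtain ⟨i, rfl⟩ := hz r
  obtain ⟨j, rfl⟩ := hz y
  have hi : ¬ Even i := fun h => hr (h.isSquare_zpow z)
  dsimp only
  by_cases hj : Even j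
  · obtain ⟨k, hk⟩ := hj
    exact ⟨z ^ k, Or.inl (by rw [hk, _root_.zpow_add, sq])⟩
  · obtain ⟨k, hk⟩ := (Int.not_even_iff_odd.1 hj).sub_odd (Int.not_even_iff_odd.1 hi)
    refine ⟨z ^ k, Or.inr ?_⟩
    rw [sq, ← _root_.zpow_add, ← _root_.zpow_add]
    congr 1
    omega

variable [Finite F]

/-- A proper subgroup containing a full split torus and without common eigenvector: an element
fixing one of the two eigenlines of the torus fixes the other one as well. -/
lemma eq_top_of_conj_diagSL_mem {H : Subgroup SL(2, F)} {z : Fˣ} (hz2 : (z : F) ^ 2 ≠ 1)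
    (hz : ∀ x : Fˣ, x ∈ Subgroup.zpowers z) {Q : SL(2, F)} (hA : Q * diagSL z * Q⁻¹ ∈ H)
    {g h : SL(2, F)} (hg : g ∈ H) (h0 : eigForm g (Q 0 0) (Q 1 0) = 0)
    (h1 : eigForm g (Q 0 1) (Q 1 1) ≠ 0) (hh : h ∈ H) (hh0 : eigForm h (Q 0 0) (Q 1 0) ≠ 0) :
    H = ⊤ := by
  set H' : Subgroup SL(2, F) := H.comap (MulAut.conj Q).toMonoidHom with hH'
  have mem : ∀ x, x ∈ H' ↔ Q * x * Q⁻¹ ∈ H := fun x => Iff.rfl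
  have mem' : ∀ x ∈ H, Q⁻¹ * x * Q ∈ H' := fun x hx => by
    rw [mem]
    simpa [mul_assoc] using hx
  have hU := upperSL_mem_of_triangular hz2 hz ((mem _).2 hA) (mem' g hg)
    (by rw [conj_apply_one_zero, h0]) (by rw [conj_apply_zero_one]; exact neg_ne_zero.2 h1)
  have htop := eq_top_of_forall_upperSL_mem hU (mem' h hh)
    (by rw [conj_apply_one_zero]; exact hh0)
  refine (Subgroup.eq_top_iff' H).2 fun x => ?_
  have hx : Q⁻¹ * x * Q ∈ H' := htop ▸ Subgroup.mem_top _
  rw [mem] at hx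
  simpa [mul_assoc] using hx

lemma eigForm_eq_zero_iff_of_ne_top {H : Subgroup SL(2, F)} (hH : H ≠ ⊤) {z : Fˣ}
    (hz2 : (z : F) ^ 2 ≠ 1) (hz : ∀ x : Fˣ, x ∈ Subgroup.zpowers z)
    (hirr : ∀ a c : F, (∀ h ∈ H, eigForm h a c = 0) → a = 0 ∧ c = 0)
    {Q : SL(2, F)} (hA : Q * diagSL z * Q⁻¹ ∈ H) {g : SL(2, F)} (hg : g ∈ H) :
    eigForm g (Q 0 0) (Q 1 0) = 0 ↔ eigForm g (Q 0 1) (Q 1 1) = 0 := by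
  have hirr' : ∀ Q : SL(2, F), ∃ h ∈ H, eigForm h (Q 0 0) (Q 1 0) ≠ 0 := by
    intro Q
    by_contra! hcon
    have hd := Q.det_two_eq_one
    rw [(hirr _ _ hcon).1, (hirr _ _ hcon).2] at hd
    simp at hd
  constructor
  · intro h0
    by_contra h1
    obtain ⟨h, hh, hh0⟩ := hirr' Q
    exact hH (eq_top_of_conj_diagSL_mem hz2 hz hA hg h0 h1 hh hh0)
  · intro h0
    by_contra h1
    obtain ⟨h, hh, hh0⟩ := hirr' (Q * weylSL F)
    have hA' : (Q * weylSL F) * diagSL z * (Q * weylSL F)⁻¹ ∈ H := by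
      rw [show (Q * weylSL F) * diagSL z * (Q * weylSL F)⁻¹ =
        Q * (weylSL F * diagSL z * (weylSL F)⁻¹) * Q⁻¹ by group, weylSL_conj_diagSL]
      exact diagSL_mem_of_generator hz hA _
    refine hH (eq_top_of_conj_diagSL_mem hz2 hz hA' hg ?_ ?_ hh hh0)
    · simpa [Matrix.mul_apply, Fin.sum_univ_two] using h0
    · simpa [eigForm, Matrix.mul_apply, Fin.sum_univ_two] using h1

/-- Two conjugate generators of split tori whose product has the opposite trace and which generate
`SL(2, F)`. -/
lemma exists_split_triple {z : Fˣ} (hz : ∀ x : Fˣ, x ∈ Subgroup.zpowers z)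
    (hord : ∀ n : ℕ, 0 < n → n < 7 → (z : F) ^ n ≠ 1) :
    ∃ B : SL(2, F), B 0 0 + B 1 1 = z + (z : F)⁻¹ ∧
      (diagSL z * B) 0 0 + (diagSL z * B) 1 1 = -(z + (z : F)⁻¹) ∧
      Subgroup.closure {diagSL z, B} = ⊤ := by
  have h1 := hord 1 (by norm_num) (by norm_num)
  have h2 := hord 2 (by norm_num) (by norm_num)
  have h3 := hord 3 (by norm_num) (by norm_num)
  have h4 := hord 4 (by norm_num) (by norm_num)
  have h5 := hord 5 (by norm_num) (by norm_num)
  have h6 := hord 6 (by norm_num) (by norm_num)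
  rw [pow_one] at h1
  have hz0 : (z : F) ≠ 0 := z.ne_zero
  obtain ⟨r, hr⟩ : ∃ r : F, r = z + (z : F)⁻¹ - 1 := ⟨_, rfl⟩
  have hr' : (z : F) ^ 2 - (r + 1) * z + 1 = 0 := by rw [hr]; field_simp; ring
  have hr0 : r ≠ 0 := by
    rintro rfl
    apply h6
    linear_combination ((z : F) ^ 4 + z ^ 3 - z - 1) * hr'
  have hr1 : r ≠ 1 := by
    rintro rfl
    apply h1
    have : ((z : F) - 1) ^ 2 = 0 := by linear_combination hr'
    exact sub_eq_zero.1 (pow_eq_zero_iff (two_ne_zero) |>.1 this)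
  have hr2 : r ^ 2 ≠ 1 := by
    intro h
    rcases mul_self_eq_one_iff.1 (sq r ▸ h) with h | h
    · exact hr1 h
    · subst h
      apply h4
      linear_combination ((z : F) ^ 2 - 1) * hr'
  obtain ⟨m, hm⟩ : ∃ m : F, m * (1 - r) = 1 :=
    ⟨(1 - r)⁻¹, inv_mul_cancel₀ (sub_ne_zero.2 hr1.symm)⟩
  have hm0 : m ≠ 0 := left_ne_zero_of_mul_eq_one hm
  obtain ⟨P, hP⟩ : ∃ P : SL(2, F), (P : Matrix (Fin 2) (Fin 2) F) = !![m, r; m, 1] :=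
    ⟨⟨!![m, r; m, 1], by rw [Matrix.det_fin_two_of]; linear_combination hm⟩, rfl⟩
  have hcj : ∀ k : Fˣ, (P * diagSL k * P⁻¹) 0 0 = m * (k - r * (k : F)⁻¹) ∧
      (P * diagSL k * P⁻¹) 0 1 = -(m * r * (k - (k : F)⁻¹)) ∧
      (P * diagSL k * P⁻¹) 1 0 = m * (k - (k : F)⁻¹) ∧
      (P * diagSL k * P⁻¹) 1 1 = m * ((k : F)⁻¹ - r * k) := by
    intro k
    refine ⟨?_, ?_, ?_, ?_⟩ <;>
      simp [hP, Matrix.mul_apply, Fin.sum_univ_two, Matrix.SpecialLinearGroup.coe_inv,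
        Matrix.adjugate_fin_two, Matrix.vecMul, dotProduct] <;> ring
  obtain ⟨B00, B01, B10, B11⟩ := hcj z
  have hzi : (z : F)⁻¹ = r + 1 - z := by rw [hr]; ring
  set B := P * diagSL z * P⁻¹ with hB
  refine ⟨B, ?_, ?_, ?_⟩
  · rw [B00, B11]
    linear_combination ((z : F) + (z : F)⁻¹) * hm
  · simp only [Matrix.SpecialLinearGroup.coe_mul, Matrix.mul_apply, Fin.sum_univ_two, diagSL_00,
      diagSL_01, diagSL_10, diagSL_11, B00, B11, B01, B10, hzi]
    linear_combination (2 * m * (1 + r)) * hr' - (r + 1) * hm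
  · by_contra hH
    set H := Subgroup.closure {diagSL z, B} with hHdef
    have hA : diagSL z ∈ H := Subgroup.subset_closure (by simp)
    have hBH : B ∈ H := Subgroup.subset_closure (by simp)
    have hdiag : ∀ x : Fˣ, diagSL x ∈ H := by
      intro x
      have := diagSL_mem_of_generator (H := H) (Q := 1) hz (by simpa using hA) x
      simpa using this
    have hPdiag : ∀ x : Fˣ, P * diagSL x * P⁻¹ ∈ H := diagSL_mem_of_generator hz hBH
    have hzz : (z : F) - (z : F)⁻¹ ≠ 0 := by
      intro h
      apply h2
      field_simp at h
      linear_combination h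
    obtain ⟨β, hβ⟩ : ∃ β : F, β = m * ((z : F) - (z : F)⁻¹) := ⟨_, rfl⟩
    have hβ0 : β ≠ 0 := hβ ▸ mul_ne_zero hm0 hzz
    have eA : ∀ a c, eigForm (diagSL z) a c = -((z : F) - (z : F)⁻¹) * (a * c) := by
      intro a c
      simp [eigForm]
      ring
    have eB : ∀ a c, eigForm B a c = β * ((a - c) * (a - r * c)) := by
      intro a c
      simp only [eigForm, B00, B01, B10, B11, hβ]
      ring
    have hirr : ∀ a c : F, (∀ h ∈ H, eigForm h a c = 0) → a = 0 ∧ c = 0 := by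
      intro a c h
      have k1 := h _ hA
      have k2 := h _ hBH
      rw [eA, mul_eq_zero, mul_eq_zero] at k1
      rw [eB, mul_eq_zero, mul_eq_zero] at k2
      have k1' := k1.resolve_left (neg_ne_zero.2 hzz)
      have k2' := k2.resolve_left hβ0
      rcases k1' with rfl | rfl
      · exact ⟨rfl, by simpa [hr0] using k2'⟩
      · exact ⟨by simpa using k2', rfl⟩
    have dich : ∀ {Q : SL(2, F)}, Q * diagSL z * Q⁻¹ ∈ H → ∀ {g : SL(2, F)}, g ∈ H →
        (eigForm g (Q 0 0) (Q 1 0) = 0 ↔ eigForm g (Q 0 1) (Q 1 1) = 0) := fun hQ _ hg =>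
      eigForm_eq_zero_iff_of_ne_top hH h2 hz hirr hQ hg
    have hconj : ∀ x : Fˣ, diagSL x * B * (diagSL x)⁻¹ ∈ H := fun x =>
      H.mul_mem (H.mul_mem (hdiag x) hBH) (H.inv_mem (hdiag x))
    have hrsq : ¬ IsSquare (Units.mk0 r hr0) := by
      rintro ⟨s, hs⟩
      have hs' : r = (s : F) * s := by
        have := congrArg Units.val hs
        simpa using this
      have hs0 : (s : F) ≠ 0 := s.ne_zero
      have key := (dich hBH (hconj s⁻¹)).1
      rw [eigForm_conj_diagSL, eigForm_conj_diagSL, eB, eB] at key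
      simp only [hP, Matrix.of_apply, Matrix.cons_val', Matrix.cons_val_zero, Matrix.cons_val_one,
        Matrix.cons_val_fin_one, Units.val_inv_eq_inv_val, inv_inv] at key
      have := key (by rw [hs']; field_simp; ring)
      rw [mul_eq_zero, mul_eq_zero] at this
      rcases this.resolve_left hβ0 with h | h
      · apply hr2
        field_simp at h
        rw [sq]
        nth_rewrite 1 [hs']
        linear_combination h
      · apply hr1
        field_simp at h
        have h' := mul_left_cancel₀ hr0 (show r * r = r * 1 by
          nth_rewrite 1 [hs']
          linear_combination h)
        exact h'
    obtain ⟨v, hv⟩ : ∃ v : F, v = (z : F) ^ 2 := ⟨_, rfl⟩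
    have hv1 : v - 1 ≠ 0 := by rw [hv]; exact sub_ne_zero.2 h2
    have hvr : v - r ≠ 0 := by
      intro h
      refine hrsq ⟨z, Units.ext ?_⟩
      simp only [Units.val_mk0, Units.val_mul]
      linear_combination hv - h
    have hG := hconj z
    have key : ∀ k : Fˣ,
        ((((k : F) ^ 2 - r) - v * ((k : F) ^ 2 - 1)) * (((k : F) ^ 2 - r) - r * v * ((k : F) ^ 2 - 1)) = 0
        ↔ (-(r * ((k : F) ^ 2 - 1)) - v * (1 - r * (k : F) ^ 2)) *
          (-(r * ((k : F) ^ 2 - 1)) - r * v * (1 - r * (k : F) ^ 2)) = 0) := by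
      intro k
      have hk0 : (k : F) ≠ 0 := k.ne_zero
      have hQ : P * diagSL k * P⁻¹ * diagSL z * (P * diagSL k * P⁻¹)⁻¹ ∈ H :=
        H.mul_mem (H.mul_mem (hPdiag k) hA) (H.inv_mem (hPdiag k))
      have d := dich hQ hG
      obtain ⟨e00, e01, e10, e11⟩ := hcj k
      rw [eigForm_conj_diagSL, eigForm_conj_diagSL, eB, eB, e00, e01, e10, e11] at d
      convert d using 1
      · rw [← mul_right_inj' (show β * m ^ 2 * ((k : F)⁻¹) ^ 2 * ((z : F)⁻¹) ^ 2 ≠ 0 by simp [hβ0, hm0, hk0, hz0]),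
          mul_zero]
        congr! 1
        rw [hv]
        field_simp
      · rw [← mul_right_inj' (show β * m ^ 2 * ((k : F)⁻¹) ^ 2 * ((z : F)⁻¹) ^ 2 ≠ 0 by simp [hβ0, hm0, hk0, hz0]),
          mul_zero]
        congr! 1
        rw [hv]
        field_simp
    have fin1 : (v - r) * (v * r - 1) ≠ (v - 1) ^ 2 := by
      intro h
      have e : (r - 1) * (((z : F) - 1) * ((z : F) ^ 3 - 1)) = 0 := by
        rw [hv] at h
        linear_combination h - (r - 1) * z * hr'
      exact mul_ne_zero (sub_ne_zero.2 hr1) (mul_ne_zero (sub_ne_zero.2 h1) (sub_ne_zero.2 h3)) e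
    have fin2 : (v - r) * (v * r - 1) ≠ r ^ 2 * (v - 1) ^ 2 := by
      intro h
      have e : (1 - r) * (((z : F) - 1) * ((z : F) ^ 5 - 1)) = 0 := by
        rw [hv] at h
        linear_combination z * h + (1 - r) * (z ^ 4 - z ^ 2 + 1) * hr'
      exact mul_ne_zero (sub_ne_zero.2 hr1.symm)
        (mul_ne_zero (sub_ne_zero.2 h1) (sub_ne_zero.2 h5)) e
    obtain ⟨k, hk | hk⟩ := exists_sq_eq_or_mul_sq_eq hz (Units.mk0 r hr0)
      (Units.mk0 ((v - r) / (v - 1)) (div_ne_zero hvr hv1)) hrsq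
    · have hk' : (k : F) ^ 2 = (v - r) / (v - 1) := by
        have := congrArg Units.val hk
        simpa using this
      rw [eq_div_iff hv1] at hk'
      have := (key k).1 (by rw [mul_eq_zero]; left; linear_combination -hk')
      rcases mul_eq_zero.1 this with h | h
      · exact mul_ne_zero (sub_ne_zero.2 hr1) hvr (by linear_combination h - r * hk')
      · have h' := mul_left_cancel₀ hr0 (show r * ((k : F) ^ 2 * (v * r - 1) - (v - 1)) = r * 0 by
          linear_combination h)
        exact fin1 (by linear_combination (v - 1) * h' - (v * r - 1) * hk')
    · have hk' : r * (k : F) ^ 2 = (v - r) / (v - 1) := by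
        have := congrArg Units.val hk
        simpa using this
      rw [eq_div_iff hv1] at hk'
      have := (key k).2 (by rw [mul_eq_zero]; left; linear_combination hk')
      rcases mul_eq_zero.1 this with h | h
      · exact mul_ne_zero (sub_ne_zero.2 hr1) hvr (by linear_combination r * h + hk')
      · exact fin2 (by linear_combination -(r * (v - 1)) * h - (v * r - 1) * hk')

end SplitTriple

section NonsplitElement

variable {F : Type*} [Field F]

lemma exists_eigenvalue_of_eigForm_eq_zero {g : SL(2, F)} {a c : F} (h : eigForm g a c = 0)
    (hac : a ≠ 0 ∨ c ≠ 0) : ∃ m : F, m ^ 2 - (g 0 0 + g 1 1) * m + 1 = 0 := by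
  have hd := g.det_two_eq_one
  by_cases hc : c = 0
  · have ha : a ≠ 0 := hac.resolve_right (not_not.2 hc)
    have h10 : g 1 0 = 0 := by simpa [eigForm, hc, ha] using h
    exact ⟨g 0 0, by rw [h10] at hd; linear_combination -hd⟩
  · refine ⟨g 1 0 * (a / c) + g 1 1, ?_⟩
    have h' : g 1 0 * (a / c) ^ 2 + (g 1 1 - g 0 0) * (a / c) - g 0 1 = 0 := by
      unfold eigForm at h
      field_simp
      linear_combination h
    linear_combination g 1 0 * h' - hd

variable {K : Type*} [Field K] [Algebra F K]

lemma algebraMap_pow_trace (g : SL(2, F)) {l : K} (hl : l ≠ 0) (hl2 : l ^ 2 ≠ 1)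
    (ht : algebraMap F K (g 0 0 + g 1 1) = l + l⁻¹) (n : ℕ) :
    algebraMap F K ((g ^ n) 0 0 + (g ^ n) 1 1) = l ^ n + l⁻¹ ^ n := by
  have hli : l * l⁻¹ = 1 := mul_inv_cancel₀ hl
  have hsub : l - l⁻¹ ≠ 0 := by
    intro h
    apply hl2
    linear_combination l * h + hli
  have h0 := g.algebraMap_pow_apply hl ht n 0 0
  have h1 := g.algebraMap_pow_apply hl ht n 1 1
  rw [map_add] at ht ⊢
  rw [Matrix.one_apply_eq] at h0 h1
  apply mul_left_cancel₀ hsub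
  linear_combination h0 + h1 + (l ^ n - l⁻¹ ^ n) * ht

variable [Fintype F] {l : K} (hl : IsPrimitiveRoot l (Fintype.card F + 1)) {X : SL(2, F)}
  (ht : algebraMap F K (X 0 0 + X 1 1) = l + l⁻¹)

include hl

lemma IsPrimitiveRoot.frobenius_eq_inv : l ^ Fintype.card F = l⁻¹ := by
  exact eq_inv_of_mul_eq_one_left (by rw [← pow_succ, hl.pow_eq_one])

lemma sq_ne_one_of_card_add_one : l ^ 2 ≠ 1 := by
  intro h
  have := Nat.le_of_dvd two_pos (hl.dvd_of_pow_eq_one 2 h)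
  have := Fintype.one_lt_card (α := F)
  omega

lemma sq_pow_eq_one_iff (n : ℕ) :
    (l ^ 2) ^ n = 1 ↔ (Fintype.card F + 1) / Nat.gcd 2 (Fintype.card F - 1) ∣ n := by
  have hc := Fintype.one_lt_card (α := F)
  have hg : Nat.gcd 2 (Fintype.card F - 1) = Nat.gcd (Fintype.card F + 1) 2 := by
    obtain ⟨k, hk⟩ : ∃ k, Fintype.card F = k + 1 := ⟨_, (Nat.sub_add_cancel hc.le).symm⟩
    rw [hk, Nat.add_sub_cancel, Nat.gcd_comm, add_assoc, Nat.gcd_add_self_left]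
  rw [hg, ← orderOf_dvd_iff_pow_eq_one, orderOf_pow' l two_ne_zero, ← hl.eq_orderOf]

include ht

lemma nonsplit_pow_mem_center_iff (n : ℕ) : X ^ n ∈ Subgroup.center SL(2, F) ↔
    (Fintype.card F + 1) / Nat.gcd 2 (Fintype.card F - 1) ∣ n := by
  rw [X.pow_mem_center_iff (hl.ne_zero (by simp)) (sq_ne_one_of_card_add_one hl) ht,
    sq_pow_eq_one_iff hl]

lemma nonsplit_pow_eq_iff (n : ℕ) (Y : SL(2, F)) : X ^ n = Y ↔ ∀ i j, (l - l⁻¹) *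
    algebraMap F K (Y i j) = (l ^ n - l⁻¹ ^ n) * algebraMap F K (X i j) +
      (l * l⁻¹ ^ n - l⁻¹ * l ^ n) * (1 : Matrix (Fin 2) (Fin 2) K) i j := by
  have hl0 := hl.ne_zero (by simp)
  have hli : l * l⁻¹ = 1 := mul_inv_cancel₀ hl0
  have hsub : l - l⁻¹ ≠ 0 := by
    intro h
    apply sq_ne_one_of_card_add_one hl
    linear_combination l * h + hli
  have key := X.algebraMap_pow_apply hl0 ht n
  constructor
  · rintro rfl
    exact key
  · intro h
    ext i j
    apply (algebraMap F K).injective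
    apply mul_left_cancel₀ hsub
    rw [key, h]

lemma orderOf_nonsplit : orderOf X = Fintype.card F + 1 := by
  have hl0 := hl.ne_zero (by simp)
  have hli : l * l⁻¹ = 1 := mul_inv_cancel₀ hl0
  have hsub : l - l⁻¹ ≠ 0 := by
    intro h
    apply sq_ne_one_of_card_add_one hl
    linear_combination l * h + hli
  rw [hl.eq_orderOf]
  refine orderOf_eq_orderOf_iff.2 fun n => ?_
  constructor
  · intro h
    have hz : X ^ n ∈ Subgroup.center SL(2, F) := h ▸ Subgroup.one_mem _
    rw [X.pow_mem_center_iff hl0 (sq_ne_one_of_card_add_one hl) ht, ← pow_mul, mul_comm,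
      pow_mul, sq, mul_eq_one_iff_eq_inv₀ (pow_ne_zero _ hl0), ← inv_pow] at hz
    have := (nonsplit_pow_eq_iff hl ht n 1).1 h 0 0
    simp only [← hz, sub_self, zero_mul, zero_add, Matrix.SpecialLinearGroup.coe_one,
      Matrix.one_apply_eq, map_one, mul_one] at this
    apply mul_left_cancel₀ hsub
    linear_combination -this
  · intro h
    rw [nonsplit_pow_eq_iff hl ht]
    intro i j
    rw [inv_pow, h]
    simp [Matrix.one_apply]

lemma nonsplit_pow_mem_center_of_eigForm_eq_zero {n : ℕ} {a c : F}
    (h : eigForm (X ^ n) a c = 0) (hac : a ≠ 0 ∨ c ≠ 0) :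
    X ^ n ∈ Subgroup.center SL(2, F) := by
  have hl0 := hl.ne_zero (by simp)
  have hli : l * l⁻¹ = 1 := mul_inv_cancel₀ hl0
  rw [X.pow_mem_center_iff hl0 (sq_ne_one_of_card_add_one hl) ht]
  obtain ⟨m, hm⟩ := exists_eigenvalue_of_eigForm_eq_zero h hac
  have hm' := congrArg (algebraMap F K) hm
  have hn : l ^ n * l⁻¹ ^ n = 1 := by rw [← mul_pow, hli, one_pow]
  rw [map_add, map_sub, map_mul, algebraMap_pow_trace X hl0 (sq_ne_one_of_card_add_one hl) ht,
    map_zero, map_one, map_pow] at hm'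
  have hmq : algebraMap F K m ^ Fintype.card F = algebraMap F K m := by
    rw [← map_pow, FiniteField.pow_card]
  have hf : (l ^ n) ^ Fintype.card F = l⁻¹ ^ n := by
    rw [pow_right_comm, hl.frobenius_eq_inv]
  have hf' : (l⁻¹ ^ n) ^ Fintype.card F = l ^ n := by
    rw [pow_right_comm, inv_pow, hl.frobenius_eq_inv, inv_inv]
  have : (algebraMap F K m - l ^ n) * (algebraMap F K m - l⁻¹ ^ n) = 0 := by
    linear_combination hm' + hn
  rw [pow_right_comm, sq]
  rcases mul_eq_zero.1 this with h | h
  · rw [sub_eq_zero.1 h, hf] at hmq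
    nth_rewrite 2 [← hmq]
    exact hn
  · rw [sub_eq_zero.1 h, hf'] at hmq
    nth_rewrite 2 [hmq]
    exact hn

lemma mem_zpowers_of_commute_nonsplit_pow {n : ℕ} (hn : X ^ n ∉ Subgroup.center SL(2, F))
    {Y : SL(2, F)} (hY : Y * X ^ n = X ^ n * Y) : Y ∈ Subgroup.zpowers X := by
  have hl0 := hl.ne_zero (by simp)
  have hli : l * l⁻¹ = 1 := mul_inv_cancel₀ hl0
  rw [X.pow_mem_center_iff hl0 (sq_ne_one_of_card_add_one hl) ht] at hn
  have hX10 : X 1 0 ≠ 0 := by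
    intro h0
    have := nonsplit_pow_mem_center_of_eigForm_eq_zero hl ht (n := 1) (a := 1) (c := 0)
      (by simp [eigForm, h0]) (by simp)
    rw [X.pow_mem_center_iff hl0 (sq_ne_one_of_card_add_one hl) ht, pow_one] at this
    exact sq_ne_one_of_card_add_one hl this
  have hne : l ^ n - l⁻¹ ^ n ≠ 0 := by
    intro h
    apply hn
    rw [pow_right_comm, sq]
    nth_rewrite 2 [sub_eq_zero.1 h]
    rw [← mul_pow, hli, one_pow]
  have hsub : l - l⁻¹ ≠ 0 := by
    intro h
    apply sq_ne_one_of_card_add_one hl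
    linear_combination l * h + hli
  have inj : Function.Injective (algebraMap F K) := (algebraMap F K).injective
  have hYm : (Y : Matrix (Fin 2) (Fin 2) F) * (X ^ n : SL(2, F)) = (X ^ n : SL(2, F)) * Y := by
    rw [← Matrix.SpecialLinearGroup.coe_mul, hY, Matrix.SpecialLinearGroup.coe_mul]
  have key := X.algebraMap_pow_apply hl0 ht n
  have k00 := key 0 0
  have k01 := key 0 1
  have k10 := key 1 0
  have k11 := key 1 1
  have c00 := congrArg (algebraMap F K) (congrFun (congrFun hYm 0) 0)
  have c10 := congrArg (algebraMap F K) (congrFun (congrFun hYm 1) 0)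
  simp only [Matrix.mul_apply, Fin.sum_univ_two, map_add, map_mul] at c00 c10
  simp only [Matrix.one_apply_eq, ne_eq, zero_ne_one, one_ne_zero, not_false_eq_true,
    Matrix.one_apply_ne, mul_zero, add_zero, mul_one] at k00 k11 k01 k10
  have e1 : Y 0 1 * X 1 0 = X 0 1 * Y 1 0 := by
    apply inj
    apply mul_left_cancel₀ hne
    rw [map_mul, map_mul]
    linear_combination (l - l⁻¹) * c00 - algebraMap F K (Y 0 1) * k10 +
      algebraMap F K (Y 1 0) * k01
  have e2 : Y 1 0 * X 0 0 + Y 1 1 * X 1 0 = X 1 0 * Y 0 0 + X 1 1 * Y 1 0 := by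
    apply inj
    apply mul_left_cancel₀ hne
    rw [map_add, map_add, map_mul, map_mul, map_mul, map_mul]
    linear_combination (l - l⁻¹) * c10 - algebraMap F K (Y 1 0) * k00 -
      algebraMap F K (Y 1 1) * k10 + algebraMap F K (Y 0 0) * k10 + algebraMap F K (Y 1 0) * k11
  obtain ⟨b, hb⟩ : ∃ b, b * X 1 0 = Y 1 0 := ⟨Y 1 0 / X 1 0, div_mul_cancel₀ _ hX10⟩
  obtain ⟨a, ha⟩ : ∃ a, a = Y 1 1 - b * X 1 1 := ⟨_, rfl⟩
  have y01 : Y 0 1 = b * X 0 1 := by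
    apply mul_right_cancel₀ hX10
    linear_combination e1 - X 0 1 * hb
  have y00 : Y 0 0 = a + b * X 0 0 := by
    apply mul_right_cancel₀ hX10
    linear_combination -e2 - (X 0 0 - X 1 1) * hb - X 1 0 * ha
  have y11 : Y 1 1 = a + b * X 1 1 := by rw [ha]; ring
  have hdX := X.det_two_eq_one
  have hdY := Y.det_two_eq_one
  have hnorm : (algebraMap F K a + algebraMap F K b * l) *
      (algebraMap F K a + algebraMap F K b * l⁻¹) = 1 := by
    have : a ^ 2 + a * b * (X 0 0 + X 1 1) + b ^ 2 = 1 := by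
      rw [y00, y01, y11, ← hb] at hdY
      linear_combination hdY - b ^ 2 * hdX
    have := congrArg (algebraMap F K) this
    rw [map_add, map_add, map_mul, ht, map_mul, map_pow, map_pow, map_one] at this
    linear_combination this + algebraMap F K b ^ 2 * hli
  have hfrob : (algebraMap F K a + algebraMap F K b * l) ^ Fintype.card F =
      algebraMap F K a + algebraMap F K b * l⁻¹ := by
    have := FiniteField.coe_frobeniusAlgHom F K
    rw [← congrFun this, map_add, map_mul, AlgHom.commutes, AlgHom.commutes, congrFun this,
      hl.frobenius_eq_inv]
  have hone : (algebraMap F K a + algebraMap F K b * l) ^ (Fintype.card F + 1) = 1 := by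
    rw [pow_succ, hfrob, mul_comm, hnorm]
  obtain ⟨j, -, hj⟩ := hl.eq_pow_of_pow_eq_one hone
  have hj' : l⁻¹ ^ j = algebraMap F K a + algebraMap F K b * l⁻¹ := by
    rw [inv_pow, hj]
    exact inv_eq_of_mul_eq_one_right hnorm
  refine ⟨j, ?_⟩
  dsimp only
  rw [zpow_natCast, nonsplit_pow_eq_iff hl ht, hj, hj']
  rw [Fin.forall_fin_two, Fin.forall_fin_two, Fin.forall_fin_two]
  rw [← hb, y00, y01, y11]
  simp only [map_add, map_mul, Matrix.one_apply_eq, ne_eq, zero_ne_one, one_ne_zero,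
    not_false_eq_true, Matrix.one_apply_ne]
  refine ⟨⟨?_, ?_⟩, ?_, ?_⟩ <;> linear_combination 0 * hli

lemma nonsplit_conj_eq_or_eq_inv {Y : SL(2, F)} (h : Y * X * Y⁻¹ ∈ Subgroup.zpowers X) :
    Y * X * Y⁻¹ = X ∨ Y * X * Y⁻¹ = X⁻¹ := by
  have hl0 := hl.ne_zero (by simp)
  have hli : l * l⁻¹ = 1 := mul_inv_cancel₀ hl0
  obtain ⟨j, hj⟩ := mem_powers_iff_mem_zpowers.2 h
  dsimp only at hj
  have htr : (X ^ j) 0 0 + (X ^ j) 1 1 = X 0 0 + X 1 1 := by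
    rw [hj, ← Matrix.trace_fin_two, ← Matrix.trace_fin_two, Matrix.SpecialLinearGroup.coe_mul,
      Matrix.trace_mul_comm, ← Matrix.SpecialLinearGroup.coe_mul, ← mul_assoc, inv_mul_cancel,
      one_mul]
  have htr' := congrArg (algebraMap F K) htr
  rw [algebraMap_pow_trace X hl0 (sq_ne_one_of_card_add_one hl) ht, ht] at htr'
  have hn : l ^ j * l⁻¹ ^ j = 1 := by rw [← mul_pow, hli, one_pow]
  have : (l ^ j - l) * (l ^ j - l⁻¹) = 0 := by
    linear_combination l ^ j * htr' - hn + hli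
  rw [← hj]
  rcases mul_eq_zero.1 this with h | h
  · left
    have h1 : l ^ (j + Fintype.card F) = 1 := by
      rw [pow_add, sub_eq_zero.1 h, ← pow_succ', hl.pow_eq_one]
    rw [hl.pow_eq_one_iff_dvd, ← orderOf_nonsplit hl ht, orderOf_dvd_iff_pow_eq_one, pow_add] at h1
    have h2 : X * X ^ Fintype.card F = 1 := by
      rw [← pow_succ', ← orderOf_nonsplit hl ht, pow_orderOf_eq_one]
    exact mul_right_cancel (h1.trans h2.symm)
  · right
    have h1 : l ^ (j + 1) = 1 := by rw [pow_succ, sub_eq_zero.1 h, inv_mul_cancel₀ hl0]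
    rw [hl.pow_eq_one_iff_dvd, ← orderOf_nonsplit hl ht, orderOf_dvd_iff_pow_eq_one, pow_succ] at h1
    exact eq_inv_of_mul_eq_one_left h1

end NonsplitElement

section CosetAction

lemma dvd_card_of_pow_apply_eq_iff {α : Type*} [DecidableEq α] (σ : Equiv.Perm α) {r : ℕ}
    (hr : 0 < r) (S : Finset α) (hS : ∀ s ∈ S, σ s ∈ S)
    (h : ∀ s ∈ S, ∀ n : ℕ, (σ ^ n) s = s ↔ r ∣ n) : r ∣ S.card := by
  set f : α → Finset α := fun s => (Finset.range r).image fun i => (σ ^ i) s with hf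
  have hSn : ∀ n : ℕ, ∀ s ∈ S, (σ ^ n) s ∈ S := by
    intro n
    induction n with
    | zero => simp
    | succ n ih =>
      intro s hs
      rw [pow_succ', Equiv.Perm.mul_apply]
      exact hS _ (ih s hs)
  have hmod : ∀ s ∈ S, ∀ n, (σ ^ n) s = (σ ^ (n % r)) s := by
    intro s hs n
    conv_lhs => rw [← Nat.mod_add_div n r, pow_add, Equiv.Perm.mul_apply]
    rw [(h s hs _).2 (dvd_mul_right r _)]
  have hcard : ∀ s ∈ S, (f s).card = r := by
    intro s hs
    rw [hf, Finset.card_image_of_injOn, Finset.card_range]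
    have aux : ∀ i j : ℕ, i ≤ j → j < r → (σ ^ i) s = (σ ^ j) s → i = j := by
      intro i j hij hj hij'
      obtain ⟨k, rfl⟩ := Nat.exists_eq_add_of_le hij
      rw [pow_add, Equiv.Perm.mul_apply, Equiv.apply_eq_iff_eq, eq_comm, h s hs] at hij'
      have := Nat.eq_zero_of_dvd_of_lt hij' (by omega)
      omega
    intro i hi j hj hij
    simp only [Finset.coe_range, Set.mem_Iio] at hi hj
    rcases le_total i j with hle | hle
    · exact aux i j hle hj hij
    · exact (aux j i hle hi hij.symm).symm
  have hself : ∀ s, s ∈ f s := fun s =>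
    Finset.mem_image.2 ⟨0, Finset.mem_range.2 hr, by simp⟩
  rw [Finset.card_eq_sum_card_image f S]
  refine Finset.dvd_sum fun b hb => ?_
  obtain ⟨s, hs, rfl⟩ := Finset.mem_image.1 hb
  suffices h1 : S.filter (fun a => f a = f s) = f s by rw [h1, hcard s hs]
  ext a
  rw [Finset.mem_filter]
  constructor
  · rintro ⟨-, ha⟩
    rw [← ha]
    exact hself a
  · intro ha
    obtain ⟨i, -, rfl⟩ := Finset.mem_image.1 ha
    have haS := hSn i s hs
    refine ⟨haS, Finset.eq_of_subset_of_card_le ?_ (by rw [hcard s hs, hcard _ haS])⟩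
    intro y hy
    obtain ⟨j, -, rfl⟩ := Finset.mem_image.1 hy
    refine Finset.mem_image.2 ⟨(j + i) % r, Finset.mem_range.2 (Nat.mod_lt _ hr), ?_⟩
    rw [← hmod s hs, pow_add, Equiv.Perm.mul_apply]

lemma dvd_card_quotient_sub {G : Type*} [Group G] [Finite G] (K : Subgroup G) (x : G) {r : ℕ}
    (hr : 0 < r) (E : Finset (G ⧸ K)) (hE : ∀ c ∈ E, x • c = c)
    (h : ∀ g : G, (g : G ⧸ K) ∉ E → ∀ n : ℕ, g⁻¹ * x ^ n * g ∈ K ↔ r ∣ n) :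
    r ∣ Nat.card (G ⧸ K) - E.card := by
  classical
  have := Fintype.ofFinite (G ⧸ K)
  rw [Nat.card_eq_fintype_card, ← Finset.card_compl]
  refine dvd_card_of_pow_apply_eq_iff (MulAction.toPerm x) hr _ ?_ ?_
  · intro s hs
    rw [Finset.mem_compl] at hs ⊢
    intro hcon
    have := hE _ hcon
    rw [MulAction.toPerm_apply] at this hcon
    rw [smul_left_cancel x this] at hcon
    exact hs hcon
  · intro s hs n
    induction s using QuotientGroup.induction_on with
    | H g =>
      rw [← h g (Finset.mem_compl.1 hs), ← MulAction.toPermHom_apply, ← map_pow,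
        MulAction.toPermHom_apply, MulAction.toPerm_apply, eq_comm,
        MulAction.Quotient.smul_coe, smul_eq_mul,
        QuotientGroup.eq, mul_assoc]

end CosetAction

section Multipliers

variable {F : Type*} [Field F] [Fintype F]

/-- The elements of `F` which multiply an additive subgroup into itself. -/
def multipliers {F : Type*} [Field F] (W : AddSubgroup F) : Set F := {a | ∀ w ∈ W, a * w ∈ W}

lemma inv_mem_multipliers {W : AddSubgroup F} {a : F} (ha : a ∈ multipliers W) :
    a⁻¹ ∈ multipliers W := by
  have hpow : ∀ n : ℕ, a ^ n ∈ multipliers W := by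
    intro n
    induction n with
    | zero => intro w hw; simpa using hw
    | succ n ih =>
      intro w hw
      rw [pow_succ, mul_assoc]
      exact ih _ (ha w hw)
  by_cases h0 : a = 0
  · rwa [h0, _root_.inv_zero, ← h0]
  · have h1 := FiniteField.pow_card_sub_one_eq_one a h0
    have hc := Fintype.one_lt_card (α := F)
    rw [show a⁻¹ = a ^ (Fintype.card F - 2) from inv_eq_of_mul_eq_one_left (by
      rw [← pow_succ, show Fintype.card F - 2 + 1 = Fintype.card F - 1 by omega, h1])]
    exact hpow _

lemma card_mul_card_multipliers_le {W : AddSubgroup F} (hW : W ≠ ⊤) :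
    Nat.card W * Nat.card (multipliers W) ≤ Fintype.card F := by
  obtain ⟨y, hy⟩ : ∃ y, y ∉ W := by
    by_contra! h
    exact hW ((AddSubgroup.eq_top_iff' W).2 h)
  rw [← Nat.card_prod, ← Nat.card_eq_fintype_card]
  refine Nat.card_le_card_of_injective
    (fun x : W × multipliers W => (x.1 : F) + (x.2 : F) * y) ?_
  rintro ⟨⟨w, hw⟩, ⟨a, ha⟩⟩ ⟨⟨w', hw'⟩, ⟨b, hb⟩⟩ h
  dsimp only at h
  have hab : a = b := by
    by_contra hne
    apply hy
    have hm : a - b ∈ multipliers W := by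
      intro v hv
      rw [sub_mul]
      exact W.sub_mem (ha v hv) (hb v hv)
    have := inv_mem_multipliers hm _ (W.sub_mem hw' hw)
    rwa [show w' - w = (a - b) * y by linear_combination -h,
      inv_mul_cancel_left₀ (sub_ne_zero.2 hne)] at this
  subst hab
  simpa using h

lemma card_multipliers_le {W : AddSubgroup F} (hW : (1 : F) ∈ W) :
    Nat.card (multipliers W) ≤ Nat.card W := by
  refine Nat.card_le_card_of_injective
    (fun a : multipliers W => (⟨a, by simpa using a.2 1 hW⟩ : W)) ?_
  rintro ⟨a, ha⟩ ⟨b, hb⟩ h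
  simpa using h

lemma card_le_gcd_mul_card_multipliers_sub_one {W : AddSubgroup F} {D : Subgroup Fˣ}
    (hD : ∀ x ∈ D, (x : F) ^ 2 ∈ multipliers W) :
    Nat.card D ≤ Nat.gcd 2 (Fintype.card F - 1) * (Nat.card (multipliers W) - 1) := by
  classical
  have hc := Fintype.one_lt_card (α := F)
  set s : Finset Fˣ := Finset.univ.filter (· ∈ D)
  set t : Finset F := Finset.univ.filter (· ∈ multipliers W)
  have hs : Nat.card D = s.card := by
    rw [Nat.card_eq_fintype_card, Fintype.card_subtype]
  have ht : Nat.card (multipliers W) = t.card := by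
    rw [Nat.card_eq_fintype_card, Fintype.card_subtype]
  have h0 : (0 : F) ∈ t := by
    simp only [t, Finset.mem_filter, Finset.mem_univ, true_and]
    intro w _
    rw [zero_mul]
    exact W.zero_mem
  rw [hs, ht, ← Finset.card_erase_of_mem h0]
  refine Finset.card_le_mul_card_image_of_maps_to (f := fun x : Fˣ => (x : F) ^ 2) ?_ _ ?_
  · intro x hx
    simp only [s, Finset.mem_filter, Finset.mem_univ, true_and] at hx
    simp only [t, Finset.mem_erase, Finset.mem_filter, Finset.mem_univ, true_and]
    exact ⟨pow_ne_zero _ x.ne_zero, hD x hx⟩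
  · intro b _
    rcases (s.filter fun x : Fˣ => (x : F) ^ 2 = b).eq_empty_or_nonempty with he | ⟨y, hy⟩
    · rw [he]
      simp
    · rw [Finset.mem_filter] at hy
      have hsub : (s.filter fun x : Fˣ => (x : F) ^ 2 = b) ⊆ {y, -y} := by
        intro x hx
        rw [Finset.mem_filter] at hx
        have := hx.2.trans hy.2.symm
        rcases sq_eq_sq_iff_eq_or_eq_neg.1 this with h | h
        · simp [Units.ext_iff, h]
        · simp [Units.ext_iff, h]
      refine (Finset.card_le_card hsub).trans ?_
      rcases (Nat.dvd_prime Nat.prime_two).1 (Nat.gcd_dvd_left 2 (Fintype.card F - 1)) with h | h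
      · rw [h]
        have heven : Fintype.card F % 2 = 0 := by
          by_contra hne
          have := Nat.dvd_gcd (dvd_refl 2) (show 2 ∣ Fintype.card F - 1 by omega)
          rw [h] at this
          omega
        have hchar := (FiniteField.even_card_iff_char_two).2 heven
        have : CharP F 2 := hchar ▸ ringChar.charP F
        have hneg : -y = y := Units.ext (by simp [CharTwo.neg_eq])
        rw [hneg]
        simp
      · rw [h]
        exact Finset.card_le_two

end Multipliers

section Borel

variable {F : Type*} [Field F]

/-- The subgroup of upper triangular matrices. -/
def borelSL (F : Type*) [Field F] : Subgroup SL(2, F) where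
  carrier := {g | g 1 0 = 0}
  mul_mem' := by
    intro a b ha hb
    simp only [Set.mem_ofPred_eq] at ha hb ⊢
    simp [Matrix.mul_apply, Fin.sum_univ_two, ha, hb]
  one_mem' := by simp
  inv_mem' := by
    intro a ha
    simp only [Set.mem_ofPred_eq] at ha ⊢
    simp [Matrix.SpecialLinearGroup.coe_inv, Matrix.adjugate_fin_two, ha]

lemma mem_borelSL {g : SL(2, F)} : g ∈ borelSL F ↔ g 1 0 = 0 := Iff.rfl

lemma conj_mem_borelSL_iff {g h : SL(2, F)} :
    h⁻¹ * g * h ∈ borelSL F ↔ eigForm g (h 0 0) (h 1 0) = 0 := by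
  rw [mem_borelSL, conj_apply_one_zero]

lemma inv_mul_mem_borelSL_iff {g h : SL(2, F)} :
    g⁻¹ * h ∈ borelSL F ↔ g 0 0 * h 1 0 = g 1 0 * h 0 0 := by
  rw [mem_borelSL, ← sub_eq_zero (a := g 0 0 * h 1 0)]
  simp [Matrix.SpecialLinearGroup.coe_inv, Matrix.adjugate_fin_two, Matrix.mul_apply,
    Fin.sum_univ_two]
  constructor <;> intro h <;> linear_combination h

/-- The translations contained in a subgroup. -/
def translations (H : Subgroup SL(2, F)) : AddSubgroup F where
  carrier := {b | upperSL b ∈ H}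
  add_mem' := by
    intro a b ha hb
    simp only [Set.mem_ofPred_eq] at ha hb ⊢
    rw [upperSL_add]
    exact H.mul_mem ha hb
  zero_mem' := by
    simp only [Set.mem_ofPred_eq, upperSL_zero]
    exact H.one_mem
  neg_mem' := by
    intro a ha
    simp only [Set.mem_ofPred_eq] at ha ⊢
    rw [upperSL_neg]
    exact H.inv_mem ha

lemma mem_translations {H : Subgroup SL(2, F)} {b : F} : b ∈ translations H ↔ upperSL b ∈ H :=
  Iff.rfl

/-- The diagonal entry of the upper triangular matrices in a subgroup. -/
def diagEntryHom (H : Subgroup SL(2, F)) : (borelSL F).subgroupOf H →* Fˣ where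
  toFun g :=
    have h10 : ((g : H) : SL(2, F)) 1 0 = 0 := g.2
    have hd := ((g : H) : SL(2, F)).det_two_eq_one
    ⟨((g : H) : SL(2, F)) 0 0, ((g : H) : SL(2, F)) 1 1,
      by rw [h10] at hd; linear_combination hd, by rw [h10] at hd; linear_combination hd⟩
  map_one' := by
    ext
    simp
  map_mul' := by
    rintro a ⟨b, hb⟩
    rw [Subgroup.mem_subgroupOf, mem_borelSL] at hb
    ext
    simp [Matrix.mul_apply, Fin.sum_univ_two, hb]

lemma mem_range_diagEntryHom {H : Subgroup SL(2, F)} {x : Fˣ} :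
    x ∈ (diagEntryHom H).range ↔ ∃ g ∈ H, g 1 0 = 0 ∧ g 0 0 = x := by
  constructor
  · rintro ⟨g, rfl⟩
    exact ⟨_, g.1.2, g.2, rfl⟩
  · rintro ⟨g, hg, h10, h00⟩
    exact ⟨⟨⟨g, hg⟩, h10⟩, Units.ext h00⟩

lemma sq_mem_multipliers {H : Subgroup SL(2, F)} {x : Fˣ} (hx : x ∈ (diagEntryHom H).range) :
    (x : F) ^ 2 ∈ multipliers (translations H) := by
  obtain ⟨g, hg, h10, h00⟩ := mem_range_diagEntryHom.1 hx
  have hd := g.det_two_eq_one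
  intro w hw
  rw [mem_translations] at hw ⊢
  have : upperSL ((x : F) ^ 2 * w) = g * upperSL w * g⁻¹ := by
    rw [eq_mul_inv_iff_mul_eq, ← h00]
    rw [h10] at hd
    apply Matrix.SpecialLinearGroup.ext_two <;>
      simp [Matrix.mul_apply, Fin.sum_univ_two, h10]
    linear_combination (g 0 0 * w) * hd
  rw [this]
  exact H.mul_mem (H.mul_mem hg hw) (H.inv_mem hg)

lemma card_borelSL_subgroupOf (H : Subgroup SL(2, F)) :
    Nat.card ((borelSL F).subgroupOf H) =
      Nat.card (translations H) * Nat.card (diagEntryHom H).range := by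
  rw [← Subgroup.card_mul_index (diagEntryHom H).ker, Subgroup.index_ker]
  congr 1
  refine Nat.card_congr ⟨fun g => ⟨((g.1.1 : H) : SL(2, F)) 0 1, ?_⟩,
    fun b => ⟨⟨⟨upperSL b, b.2⟩, rfl⟩, ?_⟩, ?_, ?_⟩
  · obtain ⟨⟨⟨g, hg⟩, h10⟩, h1⟩ := g
    have h00 : g 0 0 = 1 := congrArg Units.val h1
    have h11 : g 1 1 = 1 := congrArg Units.inv h1
    have : upperSL (g 0 1) = g :=
      Matrix.SpecialLinearGroup.ext_two h00.symm rfl (Eq.symm h10) h11.symm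
    rw [mem_translations, this]
    exact hg
  · exact Units.ext rfl
  · rintro ⟨⟨⟨g, hg⟩, h10⟩, h1⟩
    have h00 : g 0 0 = 1 := congrArg Units.val h1
    have h11 : g 1 1 = 1 := congrArg Units.inv h1
    refine Subtype.ext (Subtype.ext (Subtype.ext ?_))
    exact Matrix.SpecialLinearGroup.ext_two h00.symm rfl (Eq.symm h10) h11.symm
  · intro b
    rfl

lemma exists_injective_quotient_borelSL [DecidableEq F] (H : Subgroup SL(2, F)) :
    ∃ f : H ⧸ (borelSL F).subgroupOf H → Option F, Function.Injective f ∧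
      ∀ c s, f c = some s → ∃ h ∈ H, h 1 0 ≠ 0 ∧ h 0 0 = s * h 1 0 := by
  refine ⟨fun c => if (c.out : SL(2, F)) 1 0 = 0 then none else
    some ((c.out : SL(2, F)) 0 0 / (c.out : SL(2, F)) 1 0), ?_, ?_⟩
  · intro c c' h
    rw [← c.out_eq', ← c'.out_eq', QuotientGroup.eq, Subgroup.mem_subgroupOf, Subgroup.coe_mul,
      Subgroup.coe_inv, inv_mul_mem_borelSL_iff]
    dsimp only at h
    split_ifs at h with h1 h2 h2
    · rw [h1, h2]; simp
    · rw [Option.some_inj] at h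
      field_simp at h
      linear_combination h
  · intro c s h
    dsimp only at h
    split_ifs at h with h1
    refine ⟨c.out, c.out.2, h1, ?_⟩
    rw [Option.some_inj] at h
    rw [← h, div_mul_cancel₀ _ h1]

lemma card_quotient_borelSL_le [Fintype F] (H : Subgroup SL(2, F)) :
    Nat.card (H ⧸ (borelSL F).subgroupOf H) ≤ Fintype.card F + 1 := by
  classical
  obtain ⟨f, hf, -⟩ := exists_injective_quotient_borelSL H
  have := Nat.card_le_card_of_injective f hf
  rwa [Nat.card_eq_fintype_card (α := Option F), Fintype.card_option] at this

lemma exists_mem_of_card_quotient_borelSL [Fintype F] {H : Subgroup SL(2, F)}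
    (hc : Nat.card (H ⧸ (borelSL F).subgroupOf H) = Fintype.card F + 1) (s : F) :
    ∃ h ∈ H, h 1 0 ≠ 0 ∧ h 0 0 = s * h 1 0 := by
  classical
  obtain ⟨f, hf, hs⟩ := exists_injective_quotient_borelSL H
  have : Finite (H ⧸ (borelSL F).subgroupOf H) := Nat.finite_of_card_ne_zero (by omega)
  have hbij : Function.Bijective f := by
    rw [Nat.bijective_iff_injective_and_card]
    refine ⟨hf, ?_⟩
    rw [hc, Nat.card_eq_fintype_card, Fintype.card_option]
  obtain ⟨c, h⟩ := hbij.2 (some s)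
  exact hs c s h

end Borel

section Normalizer

variable {F K : Type*} [Field F] [Fintype F] [Field K] [Algebra F K] {l : K} {X : SL(2, F)}

lemma one_lt_card_add_one_div (hc : 2 < Fintype.card F) :
    1 < (Fintype.card F + 1) / Nat.gcd 2 (Fintype.card F - 1) := by
  rcases (Nat.dvd_prime Nat.prime_two).1 (Nat.gcd_dvd_left 2 (Fintype.card F - 1)) with h | h <;>
    rw [h] <;> omega

variable (hl : IsPrimitiveRoot l (Fintype.card F + 1))
  (ht : algebraMap F K (X 0 0 + X 1 1) = l + l⁻¹) (hc : 2 < Fintype.card F)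

include hl ht

lemma mem_zpowers_or_conj_eq_inv {g : SL(2, F)} {n : ℕ} (hn : X ^ n ∉ Subgroup.center SL(2, F))
    (h : g⁻¹ * X ^ n * g ∈ Subgroup.zpowers X) :
    g ∈ Subgroup.zpowers X ∨ g⁻¹ * X * g = X⁻¹ := by
  obtain ⟨k, hk⟩ := mem_powers_iff_mem_zpowers.2 h
  dsimp only at hk
  have hk' : X ^ k ∉ Subgroup.center SL(2, F) := by
    intro hcen
    apply hn
    have := (Subgroup.center SL(2, F)).mul_mem hcen (Subgroup.one_mem _)
    rw [show X ^ n = g * X ^ k * g⁻¹ by rw [hk]; group, (Subgroup.mem_center_iff.1 hcen g),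
      mul_assoc, mul_inv_cancel]
    exact this
  have hcomm : (g⁻¹ * X * g) * X ^ k = X ^ k * (g⁻¹ * X * g) := by
    rw [hk]
    simp only [mul_assoc, mul_inv_cancel_left]
    rw [← mul_assoc X, ← mul_assoc (X ^ n), ← pow_succ, ← pow_succ']
  have hm := mem_zpowers_of_commute_nonsplit_pow hl ht hk' hcomm
  have := nonsplit_conj_eq_or_eq_inv hl ht (Y := g⁻¹) (by rwa [inv_inv])
  rw [inv_inv] at this
  refine this.imp_left fun h1 => ?_
  refine mem_zpowers_of_commute_nonsplit_pow hl ht hn ?_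
  have h2 : Commute g X := by
    rw [Commute, SemiconjBy]
    calc g * X = g * (g⁻¹ * X * g) := by rw [h1]
      _ = X * g := by group
  exact (h2.pow_right n)

include hc

lemma nonsplit_not_mem_center : X ∉ Subgroup.center SL(2, F) := by
  intro h
  rw [← pow_one X, nonsplit_pow_mem_center_iff hl ht, Nat.dvd_one] at h
  have := one_lt_card_add_one_div hc
  omega

lemma inv_mul_mem_zpowers_of_conj_eq_inv {g h : SL(2, F)} (hg : g⁻¹ * X * g = X⁻¹)
    (hh : h⁻¹ * X * h = X⁻¹) : g⁻¹ * h ∈ Subgroup.zpowers X := by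
  refine mem_zpowers_of_commute_nonsplit_pow hl ht (n := 1)
    (by rw [pow_one]; exact nonsplit_not_mem_center hl ht hc) ?_
  rw [pow_one]
  have key : ∀ k : SL(2, F), k⁻¹ * X * k = X⁻¹ → X⁻¹ * k = k * X := by
    intro k hk
    calc X⁻¹ * k = k * (k⁻¹ * X * k)⁻¹ := by group
      _ = k * X := by rw [hk, inv_inv]
  calc g⁻¹ * h * X = g⁻¹ * (X⁻¹ * h) := by rw [key h hh, mul_assoc]
    _ = g⁻¹ * (X⁻¹ * g) * g⁻¹ * h := by group
    _ = X * (g⁻¹ * h) := by rw [key g hg]; group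

lemma dvd_card_quotient_zpowers_sub {H : Subgroup SL(2, F)} (hX : X ∈ H) :
    (Fintype.card F + 1) / Nat.gcd 2 (Fintype.card F - 1) ∣
      Nat.card (H ⧸ (Subgroup.zpowers X).subgroupOf H) - 1 ∧
        (∀ g ∈ H, ∀ n : ℕ, X ^ n ∉ Subgroup.center SL(2, F) →
          g⁻¹ * X ^ n * g ∈ Subgroup.zpowers X → g ∈ Subgroup.zpowers X) ∨
    (Fintype.card F + 1) / Nat.gcd 2 (Fintype.card F - 1) ∣
      Nat.card (H ⧸ (Subgroup.zpowers X).subgroupOf H) - 2 ∧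
        2 ≤ Nat.card (H ⧸ (Subgroup.zpowers X).subgroupOf H) ∧
        ∃ h ∈ H, h ∉ Subgroup.zpowers X ∧ h⁻¹ * X * h = X⁻¹ := by
  classical
  have hr : 0 < (Fintype.card F + 1) / Nat.gcd 2 (Fintype.card F - 1) :=
    one_pos.trans (one_lt_card_add_one_div hc)
  set C := (Subgroup.zpowers X).subgroupOf H with hC
  have hXX : X ∈ Subgroup.zpowers X := Subgroup.mem_zpowers X
  have hcen : ∀ (g : H) (n : ℕ), X ^ n ∈ Subgroup.center SL(2, F) →
      g⁻¹ * (⟨X, hX⟩ : H) ^ n * g ∈ C := by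
    intro g n hn
    rw [hC, Subgroup.mem_subgroupOf]
    simp only [Subgroup.coe_mul, Subgroup.coe_inv, Subgroup.coe_pow]
    rw [mul_assoc, ← Subgroup.mem_center_iff.1 hn, inv_mul_cancel_left]
    exact Subgroup.npow_mem_zpowers X n
  have hone : (⟨X, hX⟩ : H) • ((1 : H) : H ⧸ C) = (1 : H) := by
    rw [MulAction.Quotient.smul_coe, QuotientGroup.eq, hC, Subgroup.mem_subgroupOf]
    simp
  by_cases hex : ∃ h ∈ H, h⁻¹ * X * h = X⁻¹
  · right
    obtain ⟨h, hh, hinv⟩ := hex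
    have hmem : h ∉ Subgroup.zpowers X := by
      rintro ⟨k, rfl⟩
      dsimp only at hinv
      rw [mul_assoc, ← _root_.zpow_one_add, ← _root_.zpow_neg, ← _root_.zpow_add, neg_add_cancel_comm_assoc,
        zpow_one, eq_inv_iff_mul_eq_one, ← pow_two, ← orderOf_dvd_iff_pow_eq_one,
        orderOf_nonsplit hl ht] at hinv
      have := Nat.le_of_dvd two_pos hinv
      omega
    have hne : ((1 : H) : H ⧸ C) ≠ ((⟨h, hh⟩ : H) : H ⧸ C) := by
      intro heq
      rw [QuotientGroup.eq, hC, Subgroup.mem_subgroupOf] at heq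
      exact hmem (by simpa using heq)
    have hcard : ({((1 : H) : H ⧸ C), ((⟨h, hh⟩ : H) : H ⧸ C)} : Finset (H ⧸ C)).card = 2 :=
      Finset.card_pair hne
    refine ⟨?_, ?_, h, hh, hmem, hinv⟩
    · have := dvd_card_quotient_sub C ⟨X, hX⟩ hr
        {((1 : H) : H ⧸ C), ((⟨h, hh⟩ : H) : H ⧸ C)} ?_ ?_
      · rwa [hcard] at this
      · intro c hc'
        rw [Finset.mem_insert, Finset.mem_singleton] at hc'
        rcases hc' with rfl | rfl
        · exact hone
        · rw [MulAction.Quotient.smul_coe, QuotientGroup.eq, hC, Subgroup.mem_subgroupOf]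
          simp only [smul_eq_mul, Subgroup.coe_mul, Subgroup.coe_inv, _root_.mul_inv_rev]
          rw [← inv_mem_iff]
          simp only [_root_.mul_inv_rev, inv_inv]
          rw [← mul_assoc, hinv]
          exact inv_mem hXX
      · intro g hg n
        refine ⟨fun hmemC => ?_, fun hd => hcen g n ((nonsplit_pow_mem_center_iff hl ht n).2 hd)⟩
        by_contra hd
        rw [← nonsplit_pow_mem_center_iff hl ht n] at hd
        apply hg
        rw [Finset.mem_insert, Finset.mem_singleton]
        rcases mem_zpowers_or_conj_eq_inv hl ht hd hmemC with h1 | h1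
        · left
          rw [eq_comm, QuotientGroup.eq, hC, Subgroup.mem_subgroupOf]
          simpa using h1
        · right
          rw [QuotientGroup.eq, hC, Subgroup.mem_subgroupOf]
          exact inv_mul_mem_zpowers_of_conj_eq_inv hl ht hc h1 hinv
    · have := Finset.card_le_univ ({((1 : H) : H ⧸ C), ((⟨h, hh⟩ : H) : H ⧸ C)} : Finset (H ⧸ C))
      rwa [hcard, ← Nat.card_eq_fintype_card] at this
  · left
    have key : ∀ g ∈ H, ∀ n : ℕ, X ^ n ∉ Subgroup.center SL(2, F) →
        g⁻¹ * X ^ n * g ∈ Subgroup.zpowers X → g ∈ Subgroup.zpowers X := by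
      intro g hg n hn hm
      exact (mem_zpowers_or_conj_eq_inv hl ht hn hm).resolve_right fun h => hex ⟨g, hg, h⟩
    refine ⟨?_, key⟩
    rw [← Finset.card_singleton ((1 : H) : H ⧸ C)]
    refine dvd_card_quotient_sub C ⟨X, hX⟩ hr _ ?_ ?_
    · intro c hc'
      rw [Finset.mem_singleton.1 hc']
      exact hone
    · intro g hg n
      refine ⟨fun hmemC => ?_, fun hd => hcen g n ((nonsplit_pow_mem_center_iff hl ht n).2 hd)⟩
      by_contra hd
      rw [← nonsplit_pow_mem_center_iff hl ht n] at hd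
      apply hg
      rw [Finset.mem_singleton, eq_comm, QuotientGroup.eq, hC, Subgroup.mem_subgroupOf]
      simpa using key g g.2 n hd hmemC

end Normalizer

section Counting

variable {F K : Type*} [Field F] [Fintype F] [Field K] [Algebra F K] {l : K} {X : SL(2, F)}
  (hl : IsPrimitiveRoot l (Fintype.card F + 1))
  (ht : algebraMap F K (X 0 0 + X 1 1) = l + l⁻¹) (hc : 2 < Fintype.card F)
  {H : Subgroup SL(2, F)} (hX : X ∈ H)

lemma upperSL_pow (b : F) (n : ℕ) : upperSL b ^ n = upperSL (n * b) := by
  induction n with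
  | zero => simp [upperSL_zero]
  | succ n ih => rw [pow_succ, ih, ← upperSL_add]; congr 1; push_cast; ring

include hl ht

lemma eigForm_nonsplit_eq_zero_iff (g : SL(2, F)) (n : ℕ) :
    eigForm (X ^ n) (g 0 0) (g 1 0) = 0 ↔ X ^ n ∈ Subgroup.center SL(2, F) := by
  constructor
  · intro h
    refine nonsplit_pow_mem_center_of_eigForm_eq_zero hl ht h ?_
    by_contra! hcon
    have := g.det_two_eq_one
    rw [hcon.1, hcon.2] at this
    simp at this
  · intro h
    rw [Matrix.SpecialLinearGroup.mem_center_two_iff] at h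
    rw [eigForm, h.1, h.2.1, h.2.2]
    ring

include hX

lemma card_eq_card_quotient_zpowers_mul :
    Nat.card H = Nat.card (H ⧸ (Subgroup.zpowers X).subgroupOf H) * (Fintype.card F + 1) := by
  rw [Subgroup.card_eq_card_quotient_mul_card_subgroup ((Subgroup.zpowers X).subgroupOf H),
    Nat.card_congr (Subgroup.subgroupOfEquivOfLe ((Subgroup.zpowers_le).2 hX)).toEquiv,
    Nat.card_zpowers, orderOf_nonsplit hl ht]

lemma card_quotient_zpowers_eq
    (hn : Nat.card (H ⧸ (borelSL F).subgroupOf H) = Fintype.card F + 1) :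
    Nat.card (H ⧸ (Subgroup.zpowers X).subgroupOf H) =
      Nat.card (translations H) * Nat.card (diagEntryHom H).range := by
  have h1 := card_eq_card_quotient_zpowers_mul hl ht hX
  rw [Subgroup.card_eq_card_quotient_mul_card_subgroup ((borelSL F).subgroupOf H), hn,
    card_borelSL_subgroupOf, mul_comm] at h1
  exact (Nat.eq_of_mul_eq_mul_right (Nat.succ_pos _) h1).symm

lemma card_add_one_mul_le (hd : Nat.gcd 2 (Fintype.card F - 1) = 2)
    (hn : Nat.card (H ⧸ (borelSL F).subgroupOf H) = Fintype.card F + 1)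
    (hN : ∀ g ∈ H, ∀ n : ℕ, X ^ n ∉ Subgroup.center SL(2, F) →
      g⁻¹ * X ^ n * g ∈ Subgroup.zpowers X → g ∈ Subgroup.zpowers X) :
    (Fintype.card F + 1) * (Nat.card (translations H) - 1) ≤
      2 * Nat.card (H ⧸ (Subgroup.zpowers X).subgroupOf H) := by
  classical
  set A : Finset ℕ := Finset.range (Fintype.card F + 1) \ {0, (Fintype.card F + 1) / 2} with hA
  set B : Finset F := Finset.univ.filter (· ∈ translations H) \ {0} with hB
  have hcA : Fintype.card F - 1 ≤ A.card := by
    have h1 := Finset.le_card_sdiff ({0, (Fintype.card F + 1) / 2} : Finset ℕ)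
      (Finset.range (Fintype.card F + 1))
    have h2 := Finset.card_le_two (a := 0) (b := (Fintype.card F + 1) / 2)
    rw [hA]
    rw [Finset.card_range] at h1
    omega
  have hcB : Nat.card (translations H) - 1 ≤ B.card := by
    refine le_trans ?_ (Finset.le_card_sdiff _ _)
    rw [Finset.card_singleton, Nat.card_eq_fintype_card, Fintype.card_subtype]
  have hAmem : ∀ k ∈ A, k < Fintype.card F + 1 ∧ X ^ k ∉ Subgroup.center SL(2, F) := by
    intro k hk
    rw [hA, Finset.mem_sdiff, Finset.mem_range, Finset.mem_insert, Finset.mem_singleton] at hk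
    refine ⟨hk.1, fun h => hk.2 ?_⟩
    have hd2 : 2 ∣ Fintype.card F - 1 := hd ▸ Nat.gcd_dvd_right _ _
    have hc1 := Fintype.one_lt_card (α := F)
    rw [nonsplit_pow_mem_center_iff hl ht, hd] at h
    obtain ⟨j, hj⟩ := h
    have : j < 2 := by
      by_contra hcon
      have := Nat.mul_le_mul_left ((Fintype.card F + 1) / 2) (show 2 ≤ j by omega)
      omega
    interval_cases j <;> omega
  set f : (H ⧸ (Subgroup.zpowers X).subgroupOf H) × A ⊕ (H ⧸ (borelSL F).subgroupOf H) × B → H :=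
    Sum.elim (fun x => x.1.out * ⟨X, hX⟩ ^ (x.2 : ℕ) * x.1.out⁻¹)
      (fun x => x.1.out * ⟨upperSL x.2, by
        have := x.2.2
        simp only [hB, Finset.mem_sdiff, Finset.mem_filter] at this
        exact this.1.2⟩ * x.1.out⁻¹) with hf
  have hconj : ∀ u v x y : H, u * x * u⁻¹ = v * y * v⁻¹ → (u⁻¹ * v)⁻¹ * x * (u⁻¹ * v) = y := by
    intro u v x y h
    calc (u⁻¹ * v)⁻¹ * x * (u⁻¹ * v) = v⁻¹ * (u * x * u⁻¹) * v := by group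
      _ = y := by rw [h]; group
  have hinj : Function.Injective f := by
    rw [hf]
    refine Function.Injective.sumElim ?_ ?_ ?_
    · rintro ⟨c, k, hk⟩ ⟨c', k', hk'⟩ h
      dsimp only at h
      have hc : c = c' := by
        have h1 := congrArg Subtype.val (hconj _ _ _ _ h)
        rw [← c.out_eq', ← c'.out_eq', QuotientGroup.eq, Subgroup.mem_subgroupOf]
        refine hN _ (Subtype.prop _) k (hAmem k hk).2 ?_
        change _ = X ^ k' at h1
        exact Set.mem_of_eq_of_mem h1 (Subgroup.npow_mem_zpowers X k')
      subst hc
      have h2 := congrArg Subtype.val (mul_left_cancel (mul_right_cancel h))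
      rw [Prod.mk.injEq, Subtype.mk.injEq]
      refine ⟨rfl, pow_injOn_Iio_orderOf (x := X) ?_ ?_ h2⟩
      · rw [orderOf_nonsplit hl ht]
        exact (hAmem k hk).1
      · rw [orderOf_nonsplit hl ht]
        exact (hAmem k' hk').1
    · rintro ⟨c, b, hb⟩ ⟨c', b', hb'⟩ h
      dsimp only at h
      have hc : c = c' := by
        have h1 := congrArg Subtype.val (hconj _ _ _ _ h)
        have hb0 : b ≠ 0 := by
          simp only [hB, Finset.mem_sdiff, Finset.mem_singleton] at hb
          exact hb.2
        rw [← c.out_eq', ← c'.out_eq', QuotientGroup.eq, Subgroup.mem_subgroupOf, mem_borelSL]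
        have h2 : eigForm (upperSL b) (((c.out⁻¹ * c'.out : H) : SL(2, F)) 0 0)
            (((c.out⁻¹ * c'.out : H) : SL(2, F)) 1 0) = 0 := by
          rw [← conj_apply_one_zero]
          exact congrArg (fun g : SL(2, F) => g 1 0) h1
        simpa [eigForm, hb0] using h2
      subst hc
      have h2 := congrArg Subtype.val (mul_left_cancel (mul_right_cancel h))
      rw [Prod.mk.injEq, Subtype.mk.injEq]
      exact ⟨rfl, congrArg (fun g : SL(2, F) => g 0 1) h2⟩
    · rintro ⟨c, k, hk⟩ ⟨c', b, hb⟩ h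
      dsimp only at h
      have h1 := congrArg Subtype.val (hconj _ _ _ _ h)
      refine (hAmem k hk).2 ((eigForm_nonsplit_eq_zero_iff hl ht
        ((c.out⁻¹ * c'.out : H) : SL(2, F)) k).1 ?_)
      rw [← conj_apply_one_zero]
      exact congrArg (fun g : SL(2, F) => g 1 0) h1
  have hcard := Nat.card_le_card_of_injective f hinj
  rw [Nat.card_sum, Nat.card_prod, Nat.card_prod, hn, card_eq_card_quotient_zpowers_mul hl ht hX,
    Nat.card_eq_fintype_card (α := A), Nat.card_eq_fintype_card (α := B), Fintype.card_coe,
    Fintype.card_coe] at hcard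
  have hc1 := Fintype.one_lt_card (α := F)
  obtain ⟨k, hk⟩ : ∃ k, Fintype.card F = k + 1 := ⟨_, (Nat.sub_add_cancel hc1.le).symm⟩
  rw [hk, Nat.add_sub_cancel] at hcA
  rw [hk] at hcard ⊢
  have h1 := Nat.mul_le_mul_left (Nat.card (H ⧸ (Subgroup.zpowers X).subgroupOf H)) hcA
  have h2 := Nat.mul_le_mul_left (k + 1 + 1) hcB
  linarith

include hc

lemma card_quotient_borelSL_eq {p : ℕ} [Fact p.Prime] [CharP F p] (hu : upperSL 1 ∈ H) :
    Nat.card (H ⧸ (borelSL F).subgroupOf H) = Fintype.card F + 1 := by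
  have hp := (Fact.out : p.Prime)
  have hle := card_quotient_borelSL_le H
  have hpos : 0 < Nat.card (H ⧸ (borelSL F).subgroupOf H) := Nat.card_pos
  set n := Nat.card (H ⧸ (borelSL F).subgroupOf H)
  have hr := one_lt_card_add_one_div hc
  have h1 : (Fintype.card F + 1) / Nat.gcd 2 (Fintype.card F - 1) ∣ n := by
    have := dvd_card_quotient_sub ((borelSL F).subgroupOf H) ⟨X, hX⟩ (one_pos.trans hr) ∅
      (by simp) ?_
    · simpa using this
    intro g _ k
    rw [Subgroup.mem_subgroupOf]
    simp only [Subgroup.coe_mul, Subgroup.coe_inv, Subgroup.coe_pow]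
    rw [conj_mem_borelSL_iff, eigForm_nonsplit_eq_zero_iff hl ht,
      nonsplit_pow_mem_center_iff hl ht]
  have h2 : p ∣ n - 1 := by
    have := dvd_card_quotient_sub ((borelSL F).subgroupOf H) ⟨upperSL 1, hu⟩ hp.pos
      {((1 : H) : H ⧸ (borelSL F).subgroupOf H)} ?_ ?_
    · simpa using this
    · intro c hc'
      rw [Finset.mem_singleton.1 hc', MulAction.Quotient.smul_coe, QuotientGroup.eq,
        Subgroup.mem_subgroupOf]
      simp only [smul_eq_mul, mul_one, Subgroup.coe_inv]
      rw [inv_mem_iff, mem_borelSL]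
      simp
    · intro g hg k
      rw [Finset.mem_singleton, eq_comm, QuotientGroup.eq, Subgroup.mem_subgroupOf, inv_one,
        one_mul, mem_borelSL] at hg
      rw [Subgroup.mem_subgroupOf]
      simp only [Subgroup.coe_mul, Subgroup.coe_inv, Subgroup.coe_pow]
      rw [conj_mem_borelSL_iff, upperSL_pow, ← CharP.cast_eq_zero_iff F p]
      simp [eigForm, hg]
  have h3 : p ∣ Fintype.card F := by
    rw [← CharP.cast_eq_zero_iff F p]
    exact Nat.cast_card_eq_zero F
  rcases (Nat.dvd_prime Nat.prime_two).1 (Nat.gcd_dvd_left 2 (Fintype.card F - 1)) with h | h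
  · rw [h, Nat.div_one] at h1
    exact le_antisymm hle (Nat.le_of_dvd hpos h1)
  · have hd : 2 ∣ Fintype.card F - 1 := h ▸ Nat.gcd_dvd_right _ _
    rw [h] at h1
    obtain ⟨j, hj⟩ := h1
    have : j < 3 := by
      by_contra hcon
      have := Nat.mul_le_mul_left ((Fintype.card F + 1) / 2) (show 3 ≤ j by omega)
      omega
    interval_cases j
    · omega
    · exfalso
      have h4 : p ∣ Fintype.card F - 1 := (h2.mul_left 2).trans (dvd_of_eq (by omega))
      have h5 := (Nat.dvd_sub h3 h4)
      rw [show Fintype.card F - (Fintype.card F - 1) = 1 by omega, Nat.dvd_one] at h5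
      exact hp.one_lt.ne' h5
    · omega

lemma neg_one_mem_range_diagEntryHom (hd : Nat.gcd 2 (Fintype.card F - 1) = 2) :
    -1 ∈ (diagEntryHom H).range := by
  have hd2 : 2 ∣ Fintype.card F - 1 := hd ▸ Nat.gcd_dvd_right _ _
  have hmem : X ^ ((Fintype.card F + 1) / 2) ∈ Subgroup.center SL(2, F) := by
    rw [nonsplit_pow_mem_center_iff hl ht, hd]
  have hne : X ^ ((Fintype.card F + 1) / 2) ≠ 1 :=
    pow_ne_one_of_lt_orderOf (by omega) (by rw [orderOf_nonsplit hl ht]; omega)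
  rw [Matrix.SpecialLinearGroup.mem_center_two_iff] at hmem
  obtain ⟨h01, h10, h⟩ := hmem
  refine mem_range_diagEntryHom.2 ⟨_, H.pow_mem hX _, h10, ?_⟩
  have hdet := (X ^ ((Fintype.card F + 1) / 2)).det_two_eq_one
  rw [h10, ← h, mul_zero, sub_zero, mul_self_eq_one_iff] at hdet
  rw [Units.val_neg, Units.val_one]
  refine hdet.resolve_left fun h1 => hne ?_
  refine Matrix.SpecialLinearGroup.ext_two ?_ ?_ ?_ ?_
  · simpa using h1
  · simpa using h01
  · simpa using h10
  · simpa using h.symm.trans h1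

end Counting

section Generation

lemma even_case_arith {q w m N s : ℕ} (hN : N = w * m) (hm : 0 < m)
    (hms : m ≤ s - 1) (hws : w * s ≤ q) (hw : 2 ≤ w) :
    ¬ q + 1 ∣ N - 1 ∧ (q + 1 ∣ N - 2 → N ≤ 2) := by
  have h1 : N + w ≤ q := by
    calc N + w = w * (m + 1) := by rw [hN]; ring
      _ ≤ w * s := Nat.mul_le_mul_left w (by omega)
      _ ≤ q := hws
  have h2 : w ≤ N := hN ▸ Nat.le_mul_of_pos_right w hm
  constructor
  · intro h
    have := Nat.le_of_dvd (by omega) h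
    omega
  · intro h
    by_contra hcon
    have := Nat.le_of_dvd (by omega) h
    omega

lemma odd_case_arith_one {q w m N s : ℕ} (hq : 7 < q) (hqo : q % 2 = 1) (hN : N = w * m)
    (hms : m ≤ 2 * (s - 1)) (hws : w * s ≤ q) (hsw : s ≤ w) (hwq : w ∣ q) (hw : 2 ≤ w)
    (hle : (q + 1) * (w - 1) ≤ 2 * N) : ¬ (q + 1) / 2 ∣ N - 1 := by
  intro hd
  have hwo : w % 2 = 1 := by
    by_contra hcon
    have := (Nat.dvd_of_mod_eq_zero (show w % 2 = 0 by omega)).trans hwq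
    omega
  have hs : 0 < s := by
    by_contra hcon
    have : m = 0 := by omega
    rw [hN, this] at hle
    have := Nat.mul_pos (show 0 < q + 1 by omega) (show 0 < w - 1 by omega)
    omega
  have h1 : N + 2 * w ≤ 2 * q := by
    calc N + 2 * w = w * (m + 2) := by rw [hN]; ring
      _ ≤ w * (2 * s) := Nat.mul_le_mul_left w (by omega)
      _ ≤ 2 * q := by linarith
  by_cases h5 : 5 ≤ w
  · have := Nat.mul_le_mul_left (q + 1) (show 4 ≤ w - 1 by omega)
    omega
  · obtain rfl : w = 3 := by omega
    obtain rfl : q = 9 := by omega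
    obtain rfl : N = 12 := by omega
    omega

lemma odd_case_arith_two {p e q w m N s : ℕ} (hp : p.Prime) (hqe : q = p ^ e) (hpw : p ∣ w)
    (hq : 7 < q) (hqo : q % 2 = 1) (hN : N = w * m) (hN2 : 2 ≤ N) (hm : 2 ∣ m)
    (hms : m ≤ 2 * (s - 1)) (hws : w * s ≤ q) (hsw : s ≤ w) (hwq : w ∣ q) (hw : 2 ≤ w)
    (hd : (q + 1) / 2 ∣ N - 2) : q = 9 ∧ w = 3 ∧ m = 4 := by
  obtain ⟨m, rfl⟩ := hm
  have hprime : ∀ r : ℕ, r.Prime → r ∣ q → r = p := by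
    intro r hr hrq
    rw [hqe] at hrq
    exact (Nat.prime_dvd_prime_iff_eq hr hp).1 (hr.dvd_of_dvd_pow hrq)
  have hwo : w % 2 = 1 := by
    by_contra hcon
    have := (Nat.dvd_of_mod_eq_zero (show w % 2 = 0 by omega)).trans hwq
    omega
  have hwp : ∀ r : ℕ, r.Prime → w ∣ r → w = r ∧ p = r := by
    intro r hr hwr
    have hwr' := ((Nat.dvd_prime hr).1 hwr).resolve_left (by omega)
    exact ⟨hwr', (Nat.prime_dvd_prime_iff_eq hp hr).1 (hwr' ▸ hpw)⟩
  have hs : 0 < m := by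
    by_contra hcon
    rw [show m = 0 by omega] at hN
    omega
  have h1 : N + 2 * w ≤ 2 * q := by
    calc N + 2 * w = w * (2 * m + 2) := by rw [hN]; ring
      _ ≤ w * (2 * s) := Nat.mul_le_mul_left w (by omega)
      _ ≤ 2 * q := by linarith
  obtain ⟨j, hj⟩ := hd
  have hNw : N = 2 * (w * m) := by rw [hN]; ring
  have hww : w ∣ w * m := dvd_mul_right w m
  have hj4 : j < 4 := by
    by_contra hcon
    have := Nat.mul_le_mul_left ((q + 1) / 2) (show 4 ≤ j by omega)
    omega
  interval_cases j
  · exfalso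
    have : w ∣ 1 := by
      rw [show w * m = 1 by omega] at hww
      exact hww
    have := Nat.le_of_dvd one_pos this
    omega
  · exfalso
    have h2 : w ∣ 5 := by
      have := Nat.dvd_sub (hww.mul_left 4) hwq
      rwa [show 4 * (w * m) - q = 5 by omega] at this
    obtain ⟨rfl, rfl⟩ := hwp 5 (by norm_num) h2
    have hm4 : m ≤ 4 := by omega
    have h3 := hprime 3 (by norm_num)
    have h7 := hprime 7 (by norm_num)
    have h11 := hprime 11 (by norm_num)
    interval_cases m <;> omega
  · have h2 : w ∣ 3 := by
      have := Nat.dvd_sub (hww.mul_left 2) hwq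
      rwa [show 2 * (w * m) - q = 3 by omega] at this
    obtain ⟨rfl, rfl⟩ := hwp 3 (by norm_num) h2
    omega
  · exfalso
    have h2 : w ∣ 7 := by
      have := Nat.dvd_sub (hww.mul_left 4) (hwq.mul_left 3)
      rwa [show 4 * (w * m) - 3 * q = 7 by omega] at this
    obtain ⟨rfl, rfl⟩ := hwp 7 (by norm_num) h2
    have h5 := hprime 5 (by norm_num)
    omega

variable {F K : Type*} [Field F] [Fintype F] [Field K] [Algebra F K] {l : K} {X : SL(2, F)}
  {H : Subgroup SL(2, F)}

lemma exists_mem_multipliers_sq_eq_neg_one [CharP F 3]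
    (hn : Nat.card (H ⧸ (borelSL F).subgroupOf H) = Fintype.card F + 1)
    {g : SL(2, F)} (hg : g ∈ H) (ht : (g 0 0 + g 1 1) ^ 2 = -1) :
    ∃ y ∈ multipliers (translations H), y ^ 2 = -1 := by
  have h3 : (3 : F) = 0 := by exact_mod_cast CharP.cast_eq_zero F 3
  obtain ⟨h, hh, he⟩ : ∃ h ∈ H, eigForm g (h 0 0) (h 1 0) = 0 := by
    by_cases h10 : g 1 0 = 0
    · exact ⟨1, H.one_mem, by simp [eigForm, h10]⟩
    · obtain ⟨h, hh, -, hs⟩ :=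
        exists_mem_of_card_quotient_borelSL hn (-(g 0 0 + g 1 1 + 1 + g 1 1) / g 1 0)
      refine ⟨h, hh, ?_⟩
      have hd := g.det_two_eq_one
      have hs' : g 1 0 * h 0 0 = -(g 0 0 + g 1 1 + 1 + g 1 1) * h 1 0 := by
        rw [hs]
        field_simp
      refine (mul_eq_zero.1 (?_ : g 1 0 * eigForm g (h 0 0) (h 1 0) = 0)).resolve_left h10
      rw [eigForm]
      linear_combination (g 1 0 * h 0 0 - (g 0 0 + g 1 1 + 1 + g 1 1) * h 1 0 +
        (g 1 1 - g 0 0) * h 1 0) * hs' + (h 1 0) ^ 2 * hd + 2 * (h 1 0) ^ 2 * ht +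
        (h 1 0) ^ 2 * (g 0 0 + g 1 1) * h3
  have hb := conj_mem_borelSL_iff.2 he
  rw [mem_borelSL] at hb
  set k := h⁻¹ * g * h with hk
  have hkH : k ∈ H := H.mul_mem (H.mul_mem (H.inv_mem hh) hg) hh
  have htr : k 0 0 + k 1 1 = g 0 0 + g 1 1 := by
    rw [hk, ← Matrix.trace_fin_two, ← Matrix.trace_fin_two, Matrix.SpecialLinearGroup.coe_mul,
      Matrix.trace_mul_comm, ← Matrix.SpecialLinearGroup.coe_mul, mul_inv_cancel_left]
  have hd := k.det_two_eq_one
  rw [hb, mul_zero, sub_zero] at hd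
  have hx : Units.mkOfMulEqOne _ _ hd ∈ (diagEntryHom H).range :=
    mem_range_diagEntryHom.2 ⟨k, hkH, hb, rfl⟩
  refine ⟨_, sq_mem_multipliers hx, ?_⟩
  rw [Units.val_mkOfMulEqOne]
  rw [← htr] at ht
  linear_combination (k 0 0) ^ 2 * ht - (k 0 0 * k 1 1 + 1 + 2 * k 0 0 ^ 2) * hd - k 0 0 ^ 2 * h3

lemma four_le_card_multipliers {W : AddSubgroup F} (h2 : (2 : F) ≠ 0) {y : F}
    (hy : y ∈ multipliers W) (hy2 : y ^ 2 = -1) : 4 ≤ Nat.card (multipliers W) := by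
  classical
  have h11 : (1 : F) ≠ -1 := fun h => h2 (by linear_combination h)
  have hcard : ({0, 1, -1, y} : Finset F).card = 4 := by
    have hy0 : (0 : F) ≠ y := by
      rintro rfl
      simp at hy2
    have hy1 : (1 : F) ≠ y := by
      rintro rfl
      exact h11 (by simpa using hy2)
    have hy3 : (-1 : F) ≠ y := by
      rintro rfl
      exact h11 (by simpa using hy2)
    simp [hy0, hy1, hy3, h11]
  rw [← hcard, Nat.card_eq_fintype_card, ← Set.toFinset_card]
  refine Finset.card_le_card ?_
  intro a ha
  rw [Set.mem_toFinset]
  simp only [Finset.mem_insert, Finset.mem_singleton] at ha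
  rcases ha with rfl | rfl | rfl | rfl
  · intro w _
    rw [zero_mul]
    exact W.zero_mem
  · intro w hw
    rwa [one_mul]
  · intro w hw
    rw [neg_one_mul]
    exact W.neg_mem hw
  · exact hy

lemma eq_top_of_nonsplit_of_upperSL {p e : ℕ} [Fact p.Prime] [CharP F p]
    (hl : IsPrimitiveRoot l (Fintype.card F + 1))
    (ht : algebraMap F K (X 0 0 + X 1 1) = l + l⁻¹)
    (hF : Fintype.card F = p ^ e) (hq : 7 < Fintype.card F)
    (hX : X ∈ H) (hu : upperSL 1 ∈ H)
    (h2 : Fintype.card F % 2 = 0 → (upperSL 1)⁻¹ * X * upperSL 1 ≠ X⁻¹)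
    (h9 : Fintype.card F = 9 → ∃ g ∈ H, (g 0 0 + g 1 1) ^ 2 = -1) : H = ⊤ := by
  by_contra htop
  have hp := (Fact.out : p.Prime)
  have hc : 2 < Fintype.card F := by omega
  have hX10 : X 1 0 ≠ 0 := by
    intro h0
    refine nonsplit_not_mem_center hl ht hc ?_
    rw [← pow_one X]
    refine (eigForm_nonsplit_eq_zero_iff hl ht 1 1).1 ?_
    simp [eigForm, h0]
  have hW : translations H ≠ ⊤ := by
    intro h
    refine htop (eq_top_of_forall_upperSL_mem (fun b => ?_) hX hX10)
    rw [← mem_translations, h]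
    trivial
  have h1W : (1 : F) ∈ translations H := hu
  have hn := card_quotient_borelSL_eq hl ht hc hX (p := p) hu
  have hN := card_quotient_zpowers_eq hl ht hX hn
  have hm : 0 < Nat.card (diagEntryHom H).range := Nat.card_pos
  have hms := card_le_gcd_mul_card_multipliers_sub_one
    (W := translations H) (D := (diagEntryHom H).range) fun x hx => sq_mem_multipliers hx
  have hws := card_mul_card_multipliers_le hW
  have hsw := card_multipliers_le h1W
  have hwq : Nat.card (translations H) ∣ Fintype.card F := by
    rw [← Nat.card_eq_fintype_card]
    exact AddSubgroup.card_addSubgroup_dvd_card _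
  have hw : 2 ≤ Nat.card (translations H) := by
    have : Nontrivial (translations H) := ⟨⟨0, ⟨1, h1W⟩, by simp [Subtype.ext_iff]⟩⟩
    exact Finite.one_lt_card
  have hcases := dvd_card_quotient_zpowers_sub hl ht hc hX
  rcases (Nat.dvd_prime Nat.prime_two).1 (Nat.gcd_dvd_left 2 (Fintype.card F - 1)) with hd | hd
  · have heven : Fintype.card F % 2 = 0 := by
      by_contra hne
      have := Nat.dvd_gcd (dvd_refl 2) (show 2 ∣ Fintype.card F - 1 by omega)
      rw [hd] at this
      omega
    rw [hd, one_mul] at hms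
    rw [hd, Nat.div_one] at hcases
    have key := even_case_arith hN hm hms hws hw
    rcases hcases with ⟨h, -⟩ | ⟨h, hN2, g, hg, hgX, hinv⟩
    · exact key.1 h
    · have hind : ((Subgroup.zpowers X).subgroupOf H).index = 2 := le_antisymm (key.2 h) hN2
      have hux : upperSL 1 ∉ Subgroup.zpowers X := by
        intro hux
        obtain ⟨k, hk⟩ := mem_powers_iff_mem_zpowers.2 hux
        dsimp only at hk
        have h3 := (eigForm_nonsplit_eq_zero_iff hl ht 1 k).1 (by rw [hk]; simp [eigForm])
        rw [hk, Matrix.SpecialLinearGroup.mem_center_two_iff] at h3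
        simp at h3
      have hmem := Subgroup.mul_mem_iff_of_index_two hind (a := ⟨g, hg⟩⁻¹) (b := ⟨upperSL 1, hu⟩)
      simp only [Subgroup.mem_subgroupOf, Subgroup.coe_mul, Subgroup.coe_inv, inv_mem_iff, hgX, hux,
        iff_true] at hmem
      obtain ⟨k, hk⟩ := hmem
      dsimp only at hk
      apply h2 heven
      have hgu : upperSL 1 = g * X ^ k := by rw [hk, mul_inv_cancel_left]
      calc (upperSL 1)⁻¹ * X * upperSL 1 = (X ^ k)⁻¹ * (g⁻¹ * X * g) * X ^ k := by
            rw [hgu]; group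
        _ = X⁻¹ := by rw [hinv]; group
  · have hodd : Fintype.card F % 2 = 1 := by
      have : 2 ∣ Fintype.card F - 1 := hd ▸ Nat.gcd_dvd_right _ _
      omega
    rw [hd] at hms hcases
    rcases hcases with ⟨h, hnorm⟩ | ⟨h, hN2, -⟩
    · exact odd_case_arith_one hq hodd hN hms hws hsw hwq hw
        (card_add_one_mul_le hl ht hX hd hn hnorm) h
    · have hpw : p ∣ Nat.card (translations H) := by
        obtain ⟨k, -, hk⟩ := (Nat.dvd_prime_pow hp).1 (hF ▸ hwq)
        rw [hk] at hw ⊢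
        exact dvd_pow_self p (by rintro rfl; simp at hw)
      have h20 : (2 : F) ≠ 0 := by
        intro h20
        have : p ∣ 2 := (CharP.cast_eq_zero_iff F p 2).1 (by exact_mod_cast h20)
        rw [(Nat.prime_dvd_prime_iff_eq hp Nat.prime_two).1 this] at hpw
        have := hpw.trans hwq
        omega
      have hm2 : 2 ∣ Nat.card (diagEntryHom H).range := by
        have hneg := neg_one_mem_range_diagEntryHom hl ht hc hX hd
        have := orderOf_dvd_natCard (⟨-1, hneg⟩ : (diagEntryHom H).range)
        rwa [Subgroup.orderOf_mk, orderOf_eq_prime (p := 2) (by simp)] at this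
        intro h1
        have := congrArg Units.val h1
        rw [Units.val_neg, Units.val_one] at this
        exact h20 (by linear_combination -this)
      obtain ⟨hq9, hw3, hm4⟩ := odd_case_arith_two hp hF hpw hq hodd hN hN2 hm2 hms hws hsw hwq hw h
      rw [hw3, Nat.prime_dvd_prime_iff_eq hp Nat.prime_three] at hpw
      subst hpw
      obtain ⟨g, hg, hgt⟩ := h9 hq9
      obtain ⟨y, hy, hy2⟩ := exists_mem_multipliers_sq_eq_neg_one hn hg hgt
      have := four_le_card_multipliers h20 hy hy2
      omega

end Generation

section Existence

variable {F : Type*} [Field F] [Fintype F]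

lemma exists_algebraMap_eq_of_pow_card_eq {K : Type*} [Field K] [Algebra F K] {x : K}
    (hx : x ^ Fintype.card F = x) : ∃ y : F, algebraMap F K y = x := by
  classical
  set P : Polynomial K := Polynomial.X ^ Fintype.card F - Polynomial.X
  have hP : P ≠ 0 := FiniteField.X_pow_card_sub_X_ne_zero K Fintype.one_lt_card
  have hroot : ∀ z : K, z ^ Fintype.card F = z → z ∈ P.roots.toFinset := by
    intro z hz
    rw [Multiset.mem_toFinset, Polynomial.mem_roots hP]
    simp [P, hz]
  have hsub : Finset.univ.image (algebraMap F K) ⊆ P.roots.toFinset := by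
    intro z hz
    obtain ⟨y, -, rfl⟩ := Finset.mem_image.1 hz
    exact hroot _ (by rw [← map_pow, FiniteField.pow_card])
  have heq := Finset.eq_of_subset_of_card_le hsub (by
    rw [Finset.card_image_of_injective _ (algebraMap F K).injective, Finset.card_univ]
    refine (Multiset.toFinset_card_le _).trans ((Polynomial.card_roots' P).trans ?_)
    rw [FiniteField.X_pow_card_sub_X_natDegree_eq K Fintype.one_lt_card])
  have := hroot x hx
  rw [← heq] at this
  obtain ⟨y, -, hy⟩ := Finset.mem_image.1 this
  exact ⟨y, hy⟩

lemma exists_trace_of_isPrimitiveRoot {K : Type*} [Field K] [Algebra F K] {l : K}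
    (hl : IsPrimitiveRoot l (Fintype.card F + 1)) : ∃ t : F, algebraMap F K t = l + l⁻¹ := by
  refine exists_algebraMap_eq_of_pow_card_eq ?_
  change FiniteField.frobeniusAlgHom F K (l + l⁻¹) = _
  rw [map_add, map_inv₀, FiniteField.frobeniusAlgHom_apply, hl.frobenius_eq_inv, inv_inv, add_comm]

lemma exists_isPrimitiveRoot_card_add_one :
    ∃ l : AlgebraicClosure F, IsPrimitiveRoot l (Fintype.card F + 1) := by
  have : NeZero ((Fintype.card F + 1 : ℕ) : AlgebraicClosure F) := ⟨by
    rw [Nat.cast_add, ← map_natCast (algebraMap F (AlgebraicClosure F)), Nat.cast_card_eq_zero]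
    simp⟩
  exact HasEnoughRootsOfUnity.exists_primitiveRoot _ _

lemma two_eq_zero_iff_card_even : (2 : F) = 0 ↔ Fintype.card F % 2 = 0 := by
  rw [← FiniteField.even_card_iff_char_two]
  constructor
  · intro h
    have h1 : ringChar F ∣ 2 := (ringChar.spec F 2).1 (by exact_mod_cast h)
    refine ((Nat.dvd_prime Nat.prime_two).1 h1).resolve_left fun h2 => ?_
    exact CharP.ringChar_ne_one h2
  · intro h
    exact_mod_cast (ringChar.spec F 2).2 (dvd_of_eq h)

lemma gcd_two_card_sub_one :
    Nat.gcd 2 (Fintype.card F - 1) = if Fintype.card F % 2 = 0 then 1 else 2 := by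
  have hc := Fintype.one_lt_card (α := F)
  rcases (Nat.dvd_prime Nat.prime_two).1 (Nat.gcd_dvd_left 2 (Fintype.card F - 1)) with h | h <;>
    rw [h] <;> split_ifs with h2
  · rfl
  · have := Nat.dvd_gcd (dvd_refl 2) (show 2 ∣ Fintype.card F - 1 by omega)
    omega
  · have : 2 ∣ Fintype.card F - 1 := h ▸ Nat.gcd_dvd_right _ _
    omega
  · rfl

lemma exists_second_eigenvalue (hq : 7 < Fintype.card F) {K : Type*} [Field K] [Algebra F K] {l : K}
    (hl : IsPrimitiveRoot l (Fintype.card F + 1)) {t : F} (ht : algebraMap F K t = l + l⁻¹) :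
    ∃ (l' : K) (t' : F), l' ≠ 0 ∧ l' ^ 2 ≠ 1 ∧ algebraMap F K t' = l' + l'⁻¹ ∧ t' ≠ t ∧
      orderOf (l' ^ 2) = (Fintype.card F + 1) / Nat.gcd 2 (Fintype.card F - 1) ∧
      (Fintype.card F % 2 = 0 → t' ≠ 0) ∧
      (Fintype.card F = 9 → (2 * t' - t) ^ 2 = -1) := by
  have hl0 := hl.ne_zero (by simp)
  have hli : l * l⁻¹ = 1 := mul_inv_cancel₀ hl0
  have hr : 1 < (Fintype.card F + 1) / Nat.gcd 2 (Fintype.card F - 1) :=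
    one_lt_card_add_one_div (by omega)
  have hlpow : ∀ n : ℕ, 0 < n → n < Fintype.card F + 1 → l ^ n ≠ 1 := fun n hn hn' =>
    hl.pow_ne_one_of_pos_of_lt hn.ne' hn'
  suffices h : ∃ (l' : K) (t' : F), l' ≠ 0 ∧ algebraMap F K t' = l' + l'⁻¹ ∧ t' ≠ t ∧
      orderOf (l' ^ 2) = (Fintype.card F + 1) / Nat.gcd 2 (Fintype.card F - 1) ∧
      (Fintype.card F % 2 = 0 → t' ≠ 0) ∧
      (Fintype.card F = 9 → (2 * t' - t) ^ 2 = -1) by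
    obtain ⟨l', t', h0, h1, h2, h3, h4⟩ := h
    refine ⟨l', t', h0, ?_, h1, h2, h3, h4⟩
    intro hcon
    rw [hcon, orderOf_one] at h3
    omega
  by_cases h4 : Fintype.card F % 4 = 3
  · have h20 : (2 : F) ≠ 0 := by
      rw [Ne, two_eq_zero_iff_card_even]
      omega
    refine ⟨-l, -t, neg_ne_zero.2 hl0, by rw [map_neg, ht, _root_.inv_neg]; ring, ?_, ?_, ?_, ?_⟩
    · intro h
      have ht0 : t = 0 := by
        refine (mul_eq_zero.1 (?_ : (2 : F) * t = 0)).resolve_left h20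
        linear_combination -h
      rw [ht0, map_zero] at ht
      apply hlpow 4 (by omega) (by omega)
      linear_combination -(l ^ 3 - l) * ht - (l ^ 2 - 1) * hli
    · rw [neg_sq]
      refine Nat.dvd_right_iff_eq.1 fun n => ?_
      rw [orderOf_dvd_iff_pow_eq_one, sq_pow_eq_one_iff hl]
    · omega
    · omega
  · have h3 : ∀ n : ℕ, 0 < n → n ≤ 3 → l ^ n ≠ 1 := fun n hn hn' => hlpow n hn (by omega)
    refine ⟨l ^ 2, t ^ 2 - 2, pow_ne_zero _ hl0, ?_, ?_, ?_, ?_, ?_⟩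
    · rw [map_sub, map_pow, ht, map_ofNat, ← _root_.inv_pow]
      linear_combination 2 * hli
    · intro h
      have h' := congrArg (algebraMap F K) h
      rw [map_sub, map_pow, ht, map_ofNat] at h'
      have : (l ^ 3 - 1) * (l ^ 1 - 1) = 0 := by
        linear_combination l ^ 2 * h' - (l * l⁻¹ + 1 + 2 * l ^ 2 - l) * hli
      rcases mul_eq_zero.1 this with h1 | h1
      · exact h3 3 (by omega) le_rfl (sub_eq_zero.1 h1)
      · exact h3 1 (by omega) (by omega) (sub_eq_zero.1 h1)
    · rw [← pow_mul, orderOf_pow' _ (by norm_num), ← hl.eq_orderOf, gcd_two_card_sub_one]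
      congr 1
      rw [Nat.gcd_comm, Nat.gcd_rec]
      split_ifs with h2
      · rcases (by omega : (Fintype.card F + 1) % (2 * 2) = 1 ∨
          (Fintype.card F + 1) % (2 * 2) = 3) with h | h <;> rw [h] <;> norm_num
      · rw [show (Fintype.card F + 1) % (2 * 2) = 2 by omega]
        norm_num
    · intro h2 h
      have h' := congrArg (algebraMap F K) h
      rw [map_sub, map_pow, ht, map_ofNat, map_zero] at h'
      apply hlpow 8 (by omega) (by omega)
      linear_combination (l ^ 2 * (l ^ 4 - 1)) * h' - (l ^ 4 - 1) * (l * l⁻¹ + 1 + 2 * l ^ 2) * hli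
    · intro h9
      have h90 : (Fintype.card F : F) = 0 := Nat.cast_card_eq_zero F
      rw [h9] at h90
      have h30 : (3 : F) = 0 := by
        refine pow_eq_zero_iff (n := 2) two_ne_zero |>.1 ?_
        rw [← h90]
        norm_num
      have h5 : (l ^ 5 - 1) * (l + 1) * (l ^ 4 - l ^ 3 + l ^ 2 - l + 1) = 0 := by
        have := hl.pow_eq_one
        rw [h9] at this
        linear_combination this
      have h6 : l ^ 4 - l ^ 3 + l ^ 2 - l + 1 = 0 := by
        refine (mul_eq_zero.1 h5).resolve_left (mul_ne_zero ?_ ?_)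
        · exact sub_ne_zero.2 (hlpow 5 (by omega) (by omega))
        · intro h
          apply hlpow 2 (by omega) (by omega)
          linear_combination (l - 1) * h
      have h7 : t ^ 2 = t + 1 := by
        apply (algebraMap F K).injective
        rw [map_pow, map_add, map_one, ht]
        have h8 : l⁻¹ ^ 2 * l ^ 2 = 1 := by rw [← mul_pow, mul_comm, hli, one_pow]
        linear_combination l⁻¹ ^ 2 * h6 + (-l ^ 2 + l - 1) * h8 + (l⁻¹ + 2) * hli
      linear_combination (2 * (2 * t ^ 2 - 6) + 1) * h7 + (2 - t) * h30

lemma orderOf_mk_upperSL_one {p : ℕ} [Fact p.Prime] [CharP F p] :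
    orderOf ((upperSL 1 : SL(2, F)) : PSL2 F) = p := by
  refine orderOf_eq_prime ?_ ?_
  · rw [← QuotientGroup.mk_pow, upperSL_pow, CharP.cast_eq_zero, zero_mul, upperSL_zero]
    rfl
  · rw [Ne, QuotientGroup.eq_one_iff, Matrix.SpecialLinearGroup.mem_center_two_iff]
    simp

lemma exists_nonsplit_triple {p e : ℕ} [Fact p.Prime] [CharP F p]
    (hF : Fintype.card F = p ^ e) (hq : 7 < Fintype.card F) :
    ∃ X : SL(2, F),
      orderOf (X : PSL2 F) = (Fintype.card F + 1) / Nat.gcd 2 (Fintype.card F - 1) ∧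
      orderOf ((upperSL 1 * X : SL(2, F)) : PSL2 F) =
        (Fintype.card F + 1) / Nat.gcd 2 (Fintype.card F - 1) ∧
      Subgroup.closure {upperSL 1 * X, X⁻¹} = ⊤ := by
  obtain ⟨l, hl⟩ := exists_isPrimitiveRoot_card_add_one (F := F)
  obtain ⟨t, ht⟩ := exists_trace_of_isPrimitiveRoot hl
  obtain ⟨l', t', hl'0, hl'2, ht', hne, hord, h2, h9⟩ := exists_second_eigenvalue hq hl ht
  have hg : t' - t ≠ 0 := sub_ne_zero.2 hne
  set X : SL(2, F) := ⟨!![0, -(t' - t)⁻¹; t' - t, t], by simp [hg]⟩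
  have h00 : X 0 0 = 0 := rfl
  have h01 : X 0 1 = -(t' - t)⁻¹ := rfl
  have h10 : X 1 0 = t' - t := rfl
  have h11 : X 1 1 = t := rfl
  have htX : algebraMap F _ (X 0 0 + X 1 1) = l + l⁻¹ := by rw [h00, h11, zero_add, ht]
  have htr : ∀ b : F, (upperSL b * X) 0 0 + (upperSL b * X) 1 1 = b * (t' - t) + t := by
    intro b
    simp [Matrix.mul_apply, Fin.sum_univ_two, h00, h01, h10, h11]
  refine ⟨X, ?_, ?_, ?_⟩
  · rw [orderOf_mk_PSL2 X (hl.ne_zero (by simp)) (sq_ne_one_of_card_add_one hl) htX]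
    refine Nat.dvd_right_iff_eq.1 fun n => ?_
    rw [orderOf_dvd_iff_pow_eq_one, sq_pow_eq_one_iff hl]
  · rw [orderOf_mk_PSL2 _ hl'0 hl'2 (by rw [htr, one_mul, sub_add_cancel, ht']), hord]
  · have hX : X ∈ Subgroup.closure {upperSL 1 * X, X⁻¹} := by
      rw [← inv_mem_iff]
      exact Subgroup.subset_closure (by simp)
    have hu : upperSL 1 ∈ Subgroup.closure {upperSL 1 * X, X⁻¹} := by
      have huX : upperSL 1 * X ∈ Subgroup.closure {upperSL 1 * X, X⁻¹} :=
        Subgroup.subset_closure (by simp)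
      simpa using mul_mem huX (inv_mem hX)
    refine eq_top_of_nonsplit_of_upperSL hl htX hF hq hX hu ?_ ?_
    · intro heven hinv
      apply h2 heven
      have h20 : (2 : F) = 0 := two_eq_zero_iff_card_even.2 heven
      have h : X * upperSL 1 = upperSL 1 * X⁻¹ := by rw [← hinv]; group
      have := congrArg (fun g : SL(2, F) => g 0 0) h
      simp [Matrix.mul_apply, Fin.sum_univ_two, h00, h01, h10, h11,
        Matrix.SpecialLinearGroup.coe_inv, Matrix.adjugate_fin_two] at this
      linear_combination this + t * h20
    · intro hc9
      refine ⟨upperSL 1 ^ 2 * X, mul_mem (pow_mem hu 2) hX, ?_⟩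
      rw [upperSL_pow, htr, ← h9 hc9]
      push_cast
      ring

lemma exists_split_triple_orderOf (hq : 7 < Fintype.card F) :
    ∃ A B : SL(2, F),
      orderOf (A : PSL2 F) = (Fintype.card F - 1) / Nat.gcd 2 (Fintype.card F - 1) ∧
      orderOf (B : PSL2 F) = (Fintype.card F - 1) / Nat.gcd 2 (Fintype.card F - 1) ∧
      orderOf ((A * B : SL(2, F)) : PSL2 F) =
        (Fintype.card F - 1) / Nat.gcd 2 (Fintype.card F - 1) ∧
      Subgroup.closure {A, B} = ⊤ := by
  obtain ⟨z, hz⟩ := IsCyclic.exists_generator (α := Fˣ)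
  have hoz : orderOf (z : F) = Fintype.card F - 1 := by
    rw [orderOf_units, orderOf_eq_card_of_forall_mem_zpowers hz, Nat.card_units,
      Nat.card_eq_fintype_card]
  have hpow : ∀ n : ℕ, 0 < n → n < 7 → (z : F) ^ n ≠ 1 := fun n hn hn' =>
    pow_ne_one_of_lt_orderOf hn.ne' (by omega)
  have hz2 : (z : F) ^ 2 ≠ 1 := hpow 2 (by norm_num) (by norm_num)
  have hord : orderOf ((z : F) ^ 2) =
      (Fintype.card F - 1) / Nat.gcd 2 (Fintype.card F - 1) := by
    rw [orderOf_pow' _ two_ne_zero, hoz, Nat.gcd_comm]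
  obtain ⟨B, hB, hAB, hcl⟩ := exists_split_triple hz hpow
  refine ⟨diagSL z, B, ?_, ?_, ?_, hcl⟩
  · rw [orderOf_mk_PSL2 (K := F) (diagSL z) z.ne_zero hz2 (by simp), hord]
  · rw [orderOf_mk_PSL2 (K := F) B z.ne_zero hz2 (by rw [hB]; rfl), hord]
  · rw [orderOf_mk_PSL2 (K := F) (l := -(z : F)) _ (neg_ne_zero.2 z.ne_zero) (by rwa [neg_sq])
      (by rw [hAB, _root_.inv_neg]; exact neg_add _ _), neg_sq, hord]

lemma coprime_sub_one_div_add_one_div_mul {q p e : ℕ} (hp : p.Prime) (hq : q = p ^ e)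
    (he : 0 < e) :
    ((q - 1) / Nat.gcd 2 (q - 1)).Coprime ((q + 1) / Nat.gcd 2 (q - 1) * p) := by
  have hpq : p ∣ q := hq ▸ dvd_pow_self p he.ne'
  have hq1 : 0 < q := hq ▸ pow_pos hp.pos e
  refine Nat.Coprime.mul_right (Nat.coprime_of_dvd fun r hr h1 h2 => ?_) ?_
  · rcases (Nat.dvd_prime Nat.prime_two).1 (Nat.gcd_dvd_left 2 (q - 1)) with h | h
    · rw [h, Nat.div_one] at h1 h2
      have h3 := Nat.dvd_sub h2 h1
      rw [show q + 1 - (q - 1) = 2 by omega, Nat.prime_dvd_prime_iff_eq hr Nat.prime_two] at h3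
      have := Nat.dvd_gcd (dvd_refl 2) (h3 ▸ h1)
      omega
    · have h4 : 2 ∣ q - 1 := h ▸ Nat.gcd_dvd_right _ _
      rw [h] at h1 h2
      have h3 := Nat.dvd_sub h2 h1
      rw [show (q + 1) / 2 - (q - 1) / 2 = 1 by omega] at h3
      exact hr.one_lt.ne' (Nat.dvd_one.1 h3)
  · have h1 : (q - 1).Coprime q := by
      obtain ⟨k, rfl⟩ : ∃ k, q = k + 1 := ⟨_, (Nat.sub_add_cancel hq1).symm⟩
      simp
    exact (h1.coprime_dvd_left (Nat.div_dvd_of_dvd (Nat.gcd_dvd_right _ _))).coprime_dvd_right hpq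

end Existence

/-- Let `q = p ^ e > 7` be a prime power and `d = gcd(2, q - 1)`.  Then
`PSL₂(q)` admits an unmixed Beauville structure of type
`(((q-1)/d, (q-1)/d, (q-1)/d), ((q+1)/d, (q+1)/d, p))`. -/
theorem beauville_type_split_nonsplit_p_PSL2 (p e : ℕ) (hp : p.Prime) (he : 0 < e)
    (hq : 7 < p ^ e)
    (F : Type*) [Field F] [Fintype F] (hF : Fintype.card F = p ^ e) :
    HasBeauvilleOfType (PSL2 F)
      ((p ^ e - 1) / Nat.gcd 2 (p ^ e - 1)) ((p ^ e - 1) / Nat.gcd 2 (p ^ e - 1))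
      ((p ^ e - 1) / Nat.gcd 2 (p ^ e - 1)) ((p ^ e + 1) / Nat.gcd 2 (p ^ e - 1))
      ((p ^ e + 1) / Nat.gcd 2 (p ^ e - 1)) p := by
  have : Fact p.Prime := ⟨hp⟩
  have : CharP F p := charP_of_card_eq_prime_pow hF
  have hq' : 7 < Fintype.card F := hF ▸ hq
  obtain ⟨A, B, hA, hB, hAB, hcl⟩ := exists_split_triple_orderOf hq'
  obtain ⟨X, hX, huX, hcl'⟩ := exists_nonsplit_triple hF hq'
  have hu := orderOf_mk_upperSL_one (F := F) (p := p)
  have hcop := coprime_sub_one_div_add_one_div_mul hp hF he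
  rw [← hF]
  rw [← orderOf_inv] at hAB hX hu
  refine ⟨A, B, ((A * B : SL(2, F)) : PSL2 F)⁻¹, (upperSL 1 * X : SL(2, F)), (X⁻¹ : SL(2, F)),
    ((upperSL 1 : SL(2, F)) : PSL2 F)⁻¹, ⟨?_, ?_, closure_mk_eq_top hcl, closure_mk_eq_top hcl', ?_⟩,
    hA, hB, hAB, huX, hX, hu⟩
  · rw [QuotientGroup.mk_mul, mul_inv_cancel]
  · rw [QuotientGroup.mk_mul, QuotientGroup.mk_inv, mul_inv_cancel_right, mul_inv_cancel]
  · exact sigma3_inter_eq_one hA.dvd hB.dvd hAB.dvd (huX.dvd.trans (dvd_mul_right _ _))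
      (hX.dvd.trans (dvd_mul_right _ _)) (hu.dvd.trans (dvd_mul_left _ _)) hcop
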